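/- Fix k ≥ 1 and finite sets of integers S_{ii'} for each pair 1 ≤ i < i' ≤ k. Let a(n) denote the number of reduced generalized k × n Latin rectangles (with respect to these sets). Then the sequence a(n) is P-recursive: there exist a natural number d and polynomials p_0, p_1, …, p_d with rational coefficients, not all zero, such that Σ_{i=0}^{d} p_i(n) · a(n+i) = 0 for all sufficiently large n. -/

import Mathlib

set_option linter.all false

/-- `M` is a generalized `k × n` Latin rectangle with respect to the family of
finite sets of integers `S i i'` (relevant for `i < i'`): entries are in
`{1,…,n}` (encoded as `Fin n`), every row is a permutation of `{1,…,n}`, and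
for all rows `i < i'` and columns `j, j'` with `j' - j ∈ S i i'` one has
`M i j ≠ M i' j'`. -/
def IsGenLatinRect (k n : ℕ) (S : Fin k → Fin k → Finset ℤ)
    (M : Fin k → Fin n → Fin n) : Prop :=
  (∀ i : Fin k, Function.Bijective (M i)) ∧
  ∀ i i' : Fin k, i < i' → ∀ j j' : Fin n,
    ((j' : ℤ) - (j : ℤ)) ∈ S i i' → M i j ≠ M i' j'

/-- A generalized Latin rectangle is reduced if its first row is the identity
permutation `1, 2, …, n`. -/
def IsReducedGenLatinRect (k n : ℕ) (M : Fin k → Fin n → Fin n) : Prop :=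
  ∀ i : Fin k, (i : ℕ) = 0 → ∀ j : Fin n, M i j = j


namespace GLR
open MvPolynomial

theorem exists_aeval_of_commute {β A : Type*} [Ring A] [Algebra ℚ A] (D : β → A)
    (hD : ∀ b c, D b * D c = D c * D b) :
    ∃ φ : MvPolynomial β ℚ →ₐ[ℚ] A, ∀ b, φ (X b) = D b := by
  let _ : CommRing (Algebra.adjoin ℚ (Set.range D)) :=
    Algebra.adjoinCommRingOfComm ℚ (by
      rintro _ ⟨b, rfl⟩ _ ⟨c, rfl⟩; exact hD b c)
  let ψ : MvPolynomial β ℚ →ₐ[ℚ] Algebra.adjoin ℚ (Set.range D) :=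
    MvPolynomial.aeval (fun b => (⟨D b, Algebra.subset_adjoin ⟨b, rfl⟩⟩ : Algebra.adjoin ℚ (Set.range D)))
  refine ⟨(Algebra.adjoin ℚ (Set.range D)).val.comp ψ, fun b => ?_⟩
  simp [ψ]

variable {β : Type*} [Fintype β] [DecidableEq β]

theorem pderiv_comm' (b c : β) (f : MvPolynomial β ℚ) :
    pderiv b (pderiv c f) = pderiv c (pderiv b f) := by
  ext m
  simp only [coeff_pderiv]
  by_cases h : b = c
  · subst h; rfl
  · have h' : c ≠ b := fun e => h e.symm
    simp [Finsupp.single_apply, h, h', add_right_comm, mul_right_comm]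

theorem exists_pd (β : Type*) [Fintype β] [DecidableEq β] :
    ∃ φ : MvPolynomial β ℚ →ₐ[ℚ] Module.End ℚ (MvPolynomial β ℚ),
    ∀ b, φ (X b) = (pderiv b : Derivation ℚ (MvPolynomial β ℚ) (MvPolynomial β ℚ)).toLinearMap := by
  apply exists_aeval_of_commute
  intro b c
  exact LinearMap.ext fun f => pderiv_comm' b c f

/-- `pd p` is the constant coefficient differential operator `p(∂)`. -/
noncomputable def pd : MvPolynomial β ℚ →ₐ[ℚ] Module.End ℚ (MvPolynomial β ℚ) :=
  (exists_pd β).choose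

theorem pd_X (b : β) (f : MvPolynomial β ℚ) : pd (X b) f = pderiv b f := by
  rw [pd, (exists_pd β).choose_spec b]; rfl

theorem pd_mul (p q : MvPolynomial β ℚ) (f : MvPolynomial β ℚ) : pd (p * q) f = pd p (pd q f) := by
  rw [map_mul]; rfl

theorem pd_C (c : ℚ) (f : MvPolynomial β ℚ) : pd (C c) f = c • f := by
  have : (C c : MvPolynomial β ℚ) = algebraMap ℚ _ c := rfl
  rw [this, AlgHom.commutes]; rfl

theorem pd_add (p q : MvPolynomial β ℚ) (f : MvPolynomial β ℚ) :
    pd (p + q) f = pd p f + pd q f := by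
  rw [map_add]; rfl

theorem pd_X_mul (p : MvPolynomial β ℚ) (b : β) (f : MvPolynomial β ℚ) :
    pd p (X b * f) = X b * pd p f + pd (pderiv b p) f := by
  induction p using MvPolynomial.induction_on generalizing f with
  | C c => rw [pd_C, pd_C, pderiv_C]; simp
  | add p q hp hq =>
    rw [pd_add, pd_add, hp, hq, Derivation.map_add, pd_add]; ring
  | mul_X p c hp =>
    rw [pd_mul, pd_mul, pd_X, pd_X, Derivation.leibniz, Derivation.leibniz, smul_eq_mul,
      smul_eq_mul, smul_eq_mul, smul_eq_mul, pderiv_X, pderiv_X, map_add, hp, pd_add]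
    have e : pd (X c * pderiv b p) f = pd (pderiv b p) (pderiv c f) := by
      rw [mul_comm, pd_mul, pd_X]
    rw [e]
    by_cases h : c = b
    · subst h; simp; ring
    · have h' : b ≠ c := fun e => h e.symm
      simp [h, h']

def DegLt (d : ℕ) (f : MvPolynomial β ℚ) : Prop := ∀ m, coeff m f ≠ 0 → m.degree < d

theorem DegLt.add {d : ℕ} {f g : MvPolynomial β ℚ} (hf : DegLt d f) (hg : DegLt d g) :
    DegLt d (f + g) := by
  intro m hm
  by_cases h : coeff m f = 0
  · exact hg m (by simpa [h] using hm)
  · exact hf m h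

theorem DegLt.smul {d : ℕ} {f : MvPolynomial β ℚ} (c : ℚ) (hf : DegLt d f) :
    DegLt d (c • f) := by
  intro m hm
  exact hf m (by intro h; simp [h] at hm)

theorem DegLt.pderiv {d : ℕ} {f : MvPolynomial β ℚ} (b : β) (hf : DegLt (d + 1) f) :
    DegLt d (pderiv b f) := by
  intro m hm
  rw [coeff_pderiv] at hm
  have := hf _ (left_ne_zero_of_mul hm)
  simpa using this

theorem DegLt.mono {d e : ℕ} {f : MvPolynomial β ℚ} (hf : DegLt d f) (h : d ≤ e) : DegLt e f :=
  fun m hm => (hf m hm).trans_le h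

theorem DegLt.zero {f : MvPolynomial β ℚ} (hf : DegLt 0 f) : f = 0 := by
  ext m
  by_contra h
  exact absurd (hf m (by simpa using h)) (by omega)

theorem exists_degLt (f : MvPolynomial β ℚ) : ∃ d, DegLt d f :=
  ⟨f.totalDegree + 1, fun m hm => Nat.lt_succ_of_le (by
    have := le_totalDegree (mem_support_iff.mpr hm)
    simpa [Finsupp.degree_apply, Finsupp.sum] using this)⟩

theorem DegLt.pd {d : ℕ} (p : MvPolynomial β ℚ) : ∀ {f : MvPolynomial β ℚ}, DegLt d f →
    DegLt d (pd p f) := by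
  induction p using MvPolynomial.induction_on with
  | C c => intro f hf; rw [pd_C]; exact hf.smul c
  | add p q hp hq => intro f hf; rw [pd_add]; exact (hp hf).add (hq hf)
  | mul_X p c hp =>
    intro f hf; rw [pd_mul, pd_X]; exact hp ((hf.mono (Nat.le_succ d)).pderiv c)

theorem DegLt.pd_lt {d : ℕ} (p : MvPolynomial β ℚ) (h0 : constantCoeff p = 0)
    {f : MvPolynomial β ℚ} (hf : DegLt (d + 1) f) : DegLt d (GLR.pd p f) := by
  have key : ∀ s : Finset (β →₀ ℕ), (∀ m ∈ s, m ≠ 0) →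
      DegLt d (GLR.pd (∑ m ∈ s, monomial m (coeff m p)) f) := by
    intro s
    induction s using Finset.induction_on with
    | empty => intro _ m hm; simp at hm
    | insert m s hm ih =>
      intro hs
      rw [Finset.sum_insert hm, pd_add]
      refine DegLt.add ?_ (ih fun m' h' => hs m' (Finset.mem_insert_of_mem h'))
      have hm0 := hs m (Finset.mem_insert_self _ _)
      obtain ⟨b, hb⟩ : ∃ b, m b ≠ 0 := by
        by_contra h; push Not at h; exact hm0 (Finsupp.ext h)
      have : monomial m (coeff m p) = monomial (m - Finsupp.single b 1) (coeff m p) * X b := by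
        rw [X, monomial_mul, mul_one, tsub_add_cancel_of_le]
        simpa using Nat.one_le_iff_ne_zero.mpr hb
      rw [this, pd_mul, pd_X]
      exact DegLt.pd _ (hf.pderiv b)
  have := key p.support (by
    intro m hm h; subst h
    rw [mem_support_iff] at hm; exact hm h0)
  rwa [← as_sum] at this

theorem pd_pow_eq_zero (q : MvPolynomial β ℚ) (h0 : constantCoeff q = 0) (f : MvPolynomial β ℚ) :
    ∃ M, ∀ N ≥ M, pd (q ^ N) f = 0 := by
  have key : ∀ d (f : MvPolynomial β ℚ), DegLt d f → pd (q ^ d) f = 0 := by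
    intro d
    induction d with
    | zero => intro f hf; rw [hf.zero, map_zero]
    | succ d ih => intro f hf; rw [pow_succ, pd_mul]; exact ih _ (hf.pd_lt q h0)
  obtain ⟨d, hd⟩ := exists_degLt f
  exact ⟨d, fun N hN => key N f (hd.mono hN)⟩

theorem lam_support (q : MvPolynomial β ℚ) (h0 : constantCoeff q = 0) (f : MvPolynomial β ℚ) :
    (Function.support fun N : ℕ => (N.factorial : ℚ)⁻¹ * constantCoeff (pd (q ^ N) f)).Finite := by
  obtain ⟨M, hM⟩ := pd_pow_eq_zero q h0 f
  refine (Finset.range M).finite_toSet.subset ?_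
  intro N hN
  by_contra h
  simp only [Finset.coe_range, Set.mem_Iio, not_lt] at h
  exact hN (by simp only [hM N h, map_zero, mul_zero])

/-- The functional `f ↦ (exp(q(∂)) f)(0)`. -/
noncomputable def lam (q : MvPolynomial β ℚ) (h0 : constantCoeff q = 0) :
    MvPolynomial β ℚ →ₗ[ℚ] ℚ where
  toFun f := ∑ᶠ N : ℕ, (N.factorial : ℚ)⁻¹ * constantCoeff (pd (q ^ N) f)
  map_add' f g := by
    rw [← finsum_add_distrib (lam_support q h0 f) (lam_support q h0 g)]
    simp [mul_add]
  map_smul' c f := by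
    simp only [map_smul, RingHom.id_apply, smul_eq_mul, mul_finsum]
    refine finsum_congr fun N => ?_
    rw [← smul_eq_mul c, smul_eq_C_mul]; simp; ring

theorem lam_eq_sum (q : MvPolynomial β ℚ) (h0 : constantCoeff q = 0) (f : MvPolynomial β ℚ) (M : ℕ)
    (hM : ∀ N ≥ M, pd (q ^ N) f = 0) :
    lam q h0 f = ∑ N ∈ Finset.range M, (N.factorial : ℚ)⁻¹ * constantCoeff (pd (q ^ N) f) := by
  change finsum _ = _
  apply finsum_eq_sum_of_support_subset
  intro N hN
  by_contra h
  simp only [Finset.coe_range, Set.mem_Iio, not_lt] at h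
  exact hN (by simp only [hM N h, map_zero, mul_zero])

theorem lam_X_mul (q : MvPolynomial β ℚ) (h0 : constantCoeff q = 0) (b : β)
    (f : MvPolynomial β ℚ) : lam q h0 (X b * f) = lam q h0 (pd (pderiv b q) f) := by
  obtain ⟨M₁, h₁⟩ := pd_pow_eq_zero q h0 (X b * f)
  obtain ⟨M₂, h₂⟩ := pd_pow_eq_zero q h0 (pd (pderiv b q) f)
  rw [lam_eq_sum q h0 _ (max M₁ M₂ + 1) (fun N hN => h₁ N (by omega)),
    lam_eq_sum q h0 _ (max M₁ M₂) (fun N hN => h₂ N (by omega)), Finset.sum_range_succ']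
  simp only [pd_X_mul, map_add, map_mul, constantCoeff_X, zero_mul, zero_add]
  rw [show constantCoeff (pd (pderiv b (q ^ 0)) f) = 0 by simp, mul_zero, add_zero]
  refine Finset.sum_congr rfl fun N _ => ?_
  rw [Derivation.leibniz_pow, Nat.add_sub_cancel, smul_eq_mul, ← pd_mul, nsmul_eq_mul,
    ← map_natCast (C : ℚ →+* MvPolynomial β ℚ), pd_mul, pd_C, smul_eq_C_mul, map_mul,
    constantCoeff_C, Nat.factorial_succ]
  push_cast
  field_simp

/-- The operators `L b = t_b - (∂_b q)(∂)`. -/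
noncomputable def Lop (q : MvPolynomial β ℚ) (b : β) : Module.End ℚ (MvPolynomial β ℚ) :=
  LinearMap.mulLeft ℚ (X b) - pd (pderiv b q)

theorem Lop_apply (q : MvPolynomial β ℚ) (b : β) (f) :
    Lop q b f = X b * f - pd (pderiv b q) f := rfl

theorem exists_psi (q : MvPolynomial β ℚ) :
    ∃ ψ : MvPolynomial β ℚ →ₐ[ℚ] Module.End ℚ (MvPolynomial β ℚ), ∀ b, ψ (X b) = Lop q b := by
  apply exists_aeval_of_commute
  intro b c
  refine LinearMap.ext fun f => ?_
  simp only [Module.End.mul_apply, Lop_apply, map_sub, pd_X_mul, ← pd_mul]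
  rw [pderiv_comm' b c, mul_comm (pderiv b q)]
  ring

noncomputable def psi (q : MvPolynomial β ℚ) :
    MvPolynomial β ℚ →ₐ[ℚ] Module.End ℚ (MvPolynomial β ℚ) := (exists_psi q).choose

theorem psi_X (q : MvPolynomial β ℚ) (b : β) : psi q (X b) = Lop q b := (exists_psi q).choose_spec b

theorem lam_pd_Lop (q : MvPolynomial β ℚ) (h0 : constantCoeff q = 0) (b : β)
    (p f : MvPolynomial β ℚ) :
    lam q h0 (pd p (Lop q b f)) = lam q h0 (pd (pderiv b p) f) := by
  rw [Lop_apply, map_sub, pd_X_mul, map_sub, map_add, lam_X_mul, ← pd_mul, ← pd_mul, mul_comm]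
  ring

theorem lam_pd_psi (q : MvPolynomial β ℚ) (h0 : constantCoeff q = 0)
    (s : MvPolynomial β ℚ) : ∀ p f : MvPolynomial β ℚ,
    lam q h0 (pd p (psi q s f)) = lam q h0 (pd (pd s p) f) := by
  induction s using MvPolynomial.induction_on with
  | C c =>
    intro p f
    have : (C c : MvPolynomial β ℚ) = algebraMap ℚ _ c := rfl
    rw [pd_C, this, AlgHom.commutes, Module.algebraMap_end_apply]; simp
  | add s t hs ht =>
    intro p f
    rw [map_add, LinearMap.add_apply, map_add, map_add, hs, ht, pd_add, pd_add, map_add]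
  | mul_X s b hs =>
    intro p f
    rw [map_mul, Module.End.mul_apply, hs, psi_X, lam_pd_Lop, mul_comm, pd_mul, pd_X]

/-- `∂^γ t^δ` is a multiple of `t^(δ-γ)`. -/
theorem pd_monomial (γ : β →₀ ℕ) : ∀ δ : β →₀ ℕ,
    ∃ N : ℚ, pd (monomial γ 1) (monomial δ 1) = monomial (δ - γ) N ∧ (γ ≤ δ ↔ N ≠ 0) := by
  have hadd : ∀ γ₁ γ₂ : β →₀ ℕ,
      (∀ δ : β →₀ ℕ, ∃ N : ℚ, pd (monomial γ₁ 1) (monomial δ 1) = monomial (δ - γ₁) N ∧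
        (γ₁ ≤ δ ↔ N ≠ 0)) →
      (∀ δ : β →₀ ℕ, ∃ N : ℚ, pd (monomial γ₂ 1) (monomial δ 1) = monomial (δ - γ₂) N ∧
        (γ₂ ≤ δ ↔ N ≠ 0)) →
      (∀ δ : β →₀ ℕ, ∃ N : ℚ, pd (monomial (γ₁ + γ₂) 1) (monomial δ 1) =
        monomial (δ - (γ₁ + γ₂)) N ∧ (γ₁ + γ₂ ≤ δ ↔ N ≠ 0)) := by
    intro γ₁ γ₂ h₁ h₂ δ
    obtain ⟨N₂, e₂, i₂⟩ := h₂ δ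
    obtain ⟨N₁, e₁, i₁⟩ := h₁ (δ - γ₂)
    refine ⟨N₂ * N₁, ?_, ?_⟩
    · have : (monomial (γ₁ + γ₂) 1 : MvPolynomial β ℚ) = monomial γ₁ 1 * monomial γ₂ 1 := by
        simp [monomial_mul]
      have e3 : (monomial (δ - γ₂) N₂ : MvPolynomial β ℚ) = N₂ • monomial (δ - γ₂) 1 := by
        simp [smul_monomial]
      rw [this, pd_mul, e₂, e3, map_smul, e₁, smul_monomial, smul_eq_mul, tsub_tsub, add_comm γ₂]
    · rw [mul_ne_zero_iff, ← i₁, ← i₂]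
      constructor
      · intro h
        have h2 : γ₂ ≤ δ := le_trans le_add_self h
        exact ⟨h2, (le_tsub_iff_right h2).2 h⟩
      · rintro ⟨h2, h1⟩
        exact (le_tsub_iff_right h2).1 h1
  have hzero : ∀ δ : β →₀ ℕ, ∃ N : ℚ, pd (monomial 0 1) (monomial δ 1) =
        monomial (δ - 0) N ∧ (0 ≤ δ ↔ N ≠ 0) := by
    intro δ
    refine ⟨1, ?_, by simp⟩
    have : (monomial 0 1 : MvPolynomial β ℚ) = C 1 := rfl
    rw [this, pd_C]; simp
  induction γ using Finsupp.induction_linear with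
  | zero => exact hzero
  | add γ₁ γ₂ h₁ h₂ => exact hadd _ _ h₁ h₂
  | single b n =>
    induction n with
    | zero => simpa only [Finsupp.single_zero] using hzero
    | succ n ih =>
      rw [Finsupp.single_add]
      refine hadd _ _ ih fun δ => ⟨(δ b : ℚ), ?_, ?_⟩
      · have : (monomial (Finsupp.single b 1) 1 : MvPolynomial β ℚ) = X b := rfl
        rw [this, pd_X, pderiv_monomial, one_mul]
      · simp [Nat.one_le_iff_ne_zero]
end GLR

namespace GLR
open MvPolynomial

variable {β : Type*} [Fintype β] [DecidableEq β]

/-- Power series in `x` over `ℚ[t]`. -/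
abbrev PS (β : Type*) := PowerSeries (MvPolynomial β ℚ)

/-- Coefficientwise action of an operator. -/
noncomputable def lift (O : Module.End ℚ (MvPolynomial β ℚ)) : Module.End ℚ (PS β) where
  toFun F := PowerSeries.mk fun n => O (PowerSeries.coeff n F)
  map_add' F G := by ext1 n; simp
  map_smul' c F := by ext1 n; simp

theorem coeff_lift (O : Module.End ℚ (MvPolynomial β ℚ)) (F : PS β) (n : ℕ) :
    PowerSeries.coeff n (lift O F) = O (PowerSeries.coeff n F) := by
  simp [lift]

theorem coeff_qsmul (c : ℚ) (F : PS β) (n : ℕ) :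
    PowerSeries.coeff n (c • F) = c • PowerSeries.coeff n F := by
  simp

/-- The Euler operator. -/
noncomputable def theta : Module.End ℚ (PS β) where
  toFun F := PowerSeries.mk fun n => (n : ℚ) • PowerSeries.coeff n F
  map_add' F G := by ext1 n; simp
  map_smul' c F := by ext1 n; simp [smul_comm c]

theorem coeff_theta (F : PS β) (n : ℕ) :
    PowerSeries.coeff n (theta F) = (n : ℚ) • PowerSeries.coeff n F := by
  simp [theta]

theorem coeff_theta_pow (F : PS β) (n j : ℕ) :
    PowerSeries.coeff n ((theta ^ j) F) = (n : ℚ) ^ j • PowerSeries.coeff n F := by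
  induction j generalizing F with
  | zero => simp
  | succ j ih => rw [pow_succ, Module.End.mul_apply, ih, coeff_theta, smul_smul, pow_succ]

theorem theta_mul (F G : PS β) : theta (F * G) = theta F * G + F * theta G := by
  ext1 n
  simp only [coeff_theta, PowerSeries.coeff_mul, map_add, Finset.smul_sum]
  rw [← Finset.sum_add_distrib]
  refine Finset.sum_congr rfl fun x hx => ?_
  rw [← Finset.HasAntidiagonal.mem_antidiagonal.1 hx]
  push_cast
  simp only [smul_eq_C_mul, map_add]
  ring

theorem lift_pderiv_mul (b : β) (F G : PS β) :
    lift (pd (X b)) (F * G) = lift (pd (X b)) F * G + F * lift (pd (X b)) G := by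
  ext1 n
  simp only [coeff_lift, PowerSeries.coeff_mul, map_add, map_sum]
  rw [← Finset.sum_add_distrib]
  refine Finset.sum_congr rfl fun x hx => ?_
  rw [pd_X, pd_X, pd_X, Derivation.leibniz, smul_eq_mul, smul_eq_mul]
  ring

/-- The generating monomials. -/
noncomputable def gen (i : ℕ) (m : β →₀ ℕ) : PS β := PowerSeries.monomial i (monomial m 1)

/-- Polynomials with all partial degrees at most `d`. -/
noncomputable def Pol (β : Type*) [Fintype β] [DecidableEq β] (d : ℕ) : Submodule ℚ (PS β) :=
  Submodule.span ℚ (Set.range fun x : Fin (d + 1) × (β → Fin (d + 1)) =>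
    gen (x.1 : ℕ) (Finsupp.equivFunOnFinite.symm fun b => (x.2 b : ℕ)))

theorem gen_mem {i d : ℕ} {m : β →₀ ℕ} (hi : i ≤ d) (hm : ∀ b, m b ≤ d) : gen i m ∈ Pol β d := by
  refine Submodule.subset_span ⟨(⟨i, by omega⟩, fun b => ⟨m b, by have := hm b; omega⟩), ?_⟩
  simp only
  congr 1
  ext b; simp

theorem Pol_le {d : ℕ} (S : Submodule ℚ (PS β))
    (h : ∀ i m, i ≤ d → (∀ b : β, m b ≤ d) → gen i m ∈ S) : Pol β d ≤ S := by
  refine Submodule.span_le.2 ?_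
  rintro _ ⟨x, rfl⟩
  exact h _ _ (by have := x.1.2; omega) (fun b => by have := (x.2 b).2; simp; omega)

theorem Pol_mono {d e : ℕ} (h : d ≤ e) : Pol β d ≤ Pol β e :=
  Pol_le _ fun i m hi hm => gen_mem (hi.trans h) fun b => (hm b).trans h

theorem gen_mul (i j : ℕ) (m k : β →₀ ℕ) : gen i m * gen j k = gen (i + j) (m + k) := by
  simp [gen, PowerSeries.monomial_mul_monomial, monomial_mul]

theorem Pol_mul {d e : ℕ} {F G : PS β} (hF : F ∈ Pol β d) (hG : G ∈ Pol β e) :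
    F * G ∈ Pol β (d + e) := by
  have h1 : ∀ i m, i ≤ d → (∀ b : β, m b ≤ d) → ∀ G ∈ Pol β e, gen i m * G ∈ Pol β (d + e) := by
    intro i m hi hm
    have := Pol_le (d := e) ((Pol β (d + e)).comap (LinearMap.mulLeft ℚ (gen i m))) (by
      intro j k hj hk
      rw [Submodule.mem_comap, LinearMap.mulLeft_apply, gen_mul]
      exact gen_mem (by omega) fun b => by have := hm b; have := hk b; simp; omega)
    exact this
  have := Pol_le (d := d) ((Pol β (d + e)).comap (LinearMap.mulRight ℚ G)) (by
    intro i m hi hm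
    exact h1 i m hi hm G hG)
  exact this hF

theorem theta_Pol {d : ℕ} {F : PS β} (hF : F ∈ Pol β d) : theta F ∈ Pol β d := by
  have := Pol_le (d := d) ((Pol β d).comap theta) (by
    intro i m hi hm
    have : theta (gen i m) = (i : ℚ) • gen i m := by
      ext1 n
      rw [coeff_theta, coeff_qsmul]
      by_cases h : n = i
      · rw [h]
      · simp [gen, PowerSeries.coeff_monomial, h]
    rw [Submodule.mem_comap, this]
    exact Submodule.smul_mem _ _ (gen_mem hi hm))
  exact this hF

theorem pd_Pol {d : ℕ} (b : β) {F : PS β} (hF : F ∈ Pol β d) : lift (pd (X b)) F ∈ Pol β d := by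
  have := Pol_le (d := d) ((Pol β d).comap (lift (pd (X b)))) (by
    intro i m hi hm
    have : lift (pd (X b)) (gen i m) = (m b : ℚ) • gen i (m - Finsupp.single b 1) := by
      ext1 n
      rw [coeff_lift, coeff_qsmul, pd_X]
      by_cases h : n = i
      · simp [gen, PowerSeries.coeff_monomial, h, pderiv_monomial, smul_monomial]
      · simp [gen, PowerSeries.coeff_monomial, h]
    rw [Submodule.mem_comap, this]
    exact Submodule.smul_mem _ _ (gen_mem hi fun c => by
      have := hm c; simp; omega))
  exact this hF

theorem exists_Pol (p : Polynomial (MvPolynomial β ℚ)) : ∃ d, (p : PS β) ∈ Pol β d := by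
  induction p using Polynomial.induction_on' with
  | add p q hp hq =>
    obtain ⟨d, hd⟩ := hp
    obtain ⟨e, he⟩ := hq
    refine ⟨d + e, ?_⟩
    rw [Polynomial.coe_add]
    exact Submodule.add_mem _ (Pol_mono (by omega) hd) (Pol_mono (by omega) he)
  | monomial n a =>
    rw [Polynomial.coe_monomial]
    induction a using MvPolynomial.induction_on' with
    | monomial m c =>
      refine ⟨n + m.degree, ?_⟩
      have : (PowerSeries.monomial n (monomial m c) : PS β) = c • gen n m := by
        rw [gen, ← LinearMap.map_smul_of_tower, smul_monomial]; simp
      rw [this]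
      exact Submodule.smul_mem _ _ (gen_mem (by omega) fun b => (Finsupp.le_degree b m).trans (by omega))
    | add p q hp hq =>
      obtain ⟨d, hd⟩ := hp
      obtain ⟨e, he⟩ := hq
      refine ⟨d + e, ?_⟩
      rw [map_add]
      exact Submodule.add_mem _ (Pol_mono (by omega) hd) (Pol_mono (by omega) he)

/-- The Bernstein type filtration. -/
noncomputable def V (D : PS β) (c m : ℕ) : Submodule ℚ (PS β) :=
  (Pol β (c * m)).comap (LinearMap.mulLeft ℚ (D ^ m))

theorem mem_V {D : PS β} {c m : ℕ} {g : PS β} : g ∈ V D c m ↔ D ^ m * g ∈ Pol β (c * m) := Iff.rfl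

theorem V_mul {D : PS β} {c m : ℕ} {g h : PS β} (hg : g ∈ V D c m) (h1 : h * D ∈ Pol β c) :
    h * g ∈ V D c (m + 1) := by
  rw [mem_V] at *
  have : D ^ (m + 1) * (h * g) = (D ^ m * g) * (h * D) := by ring
  rw [this, mul_add, mul_one]
  exact Pol_mul hg h1

theorem V_mono {D : PS β} {c m e : ℕ} (hD : D ∈ Pol β c) (h : m ≤ e) : V D c m ≤ V D c e := by
  induction e, h using Nat.le_induction with
  | base => exact le_rfl
  | succ e _ ih =>
    intro g hg
    have := V_mul (ih hg) (h := 1) (by simpa using hD)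
    simpa using this

theorem V_der {D : PS β} {c m : ℕ} (δ : Module.End ℚ (PS β))
    (hδ : ∀ F G, δ (F * G) = δ F * G + F * δ G) (hP : ∀ d F, F ∈ Pol β d → δ F ∈ Pol β d)
    (hD : D ∈ Pol β c) {g : PS β} (hg : g ∈ V D c m) : δ g ∈ V D c (m + 1) := by
  rw [mem_V] at *
  have h1 : δ (1 : PS β) = 0 := by
    have := hδ 1 1
    rw [one_mul, mul_one, one_mul] at this
    exact left_eq_add.1 this
  have hpow : ∀ m : ℕ, D * δ (D ^ m) = (m : PS β) * (D ^ m * δ D) := by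
    intro m
    induction m with
    | zero => rw [pow_zero, h1]; push_cast; ring
    | succ m ih =>
      rw [pow_succ, hδ, mul_add, ← mul_assoc, ih]
      push_cast
      ring
  have h3 : D ^ (m + 1) * δ g = δ (D ^ m * g) * D - (m : PS β) * ((D ^ m * g) * δ D) := by
    rw [hδ, add_mul]
    have h2 : δ (D ^ m) * g * D = (m : PS β) * (D ^ m * δ D) * g := by rw [← hpow m]; ring
    rw [h2]
    ring
  rw [h3, mul_add, mul_one, ← nsmul_eq_mul]
  exact Submodule.sub_mem _ (Pol_mul (hP _ _ hg) hD)
    (Submodule.smul_of_tower_mem _ _ (Pol_mul hg (hP _ _ hD)))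

theorem lift_pd_V {D : PS β} {c : ℕ} (hD : D ∈ Pol β c) (p : MvPolynomial β ℚ) :
    ∃ K, ∀ m g, g ∈ V D c m → lift (pd p) g ∈ V D c (m + K) := by
  induction p using MvPolynomial.induction_on with
  | C a =>
    refine ⟨0, fun m g hg => ?_⟩
    have : lift (pd (C a)) g = a • g := by
      ext1 n; rw [coeff_lift, pd_C, coeff_qsmul]
    rw [this]; exact Submodule.smul_mem _ _ hg
  | add p q hp hq =>
    obtain ⟨K₁, h₁⟩ := hp
    obtain ⟨K₂, h₂⟩ := hq
    refine ⟨K₁ + K₂, fun m g hg => ?_⟩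
    have : lift (pd (p + q)) g = lift (pd p) g + lift (pd q) g := by
      ext1 n; rw [coeff_lift, pd_add, map_add, coeff_lift, coeff_lift]
    rw [this]
    exact Submodule.add_mem _ (V_mono hD (by omega) (h₁ m g hg)) (V_mono hD (by omega) (h₂ m g hg))
  | mul_X p b hp =>
    obtain ⟨K₁, h₁⟩ := hp
    refine ⟨K₁ + 1, fun m g hg => ?_⟩
    have : lift (pd (p * X b)) g = lift (pd p) (lift (pd (X b)) g) := by
      ext1 n; rw [coeff_lift, pd_mul, coeff_lift, coeff_lift]
    rw [this]
    have := h₁ _ _ (V_der (lift (pd (X b))) (lift_pderiv_mul b) (fun d F hF => pd_Pol b hF) hD hg)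
    rwa [add_assoc, add_comm 1] at this

theorem lift_Lop_V {D : PS β} {c : ℕ} (hD : D ∈ Pol β c) (hD' : ∀ b, PowerSeries.C (X b) * D ∈ Pol β c)
    (q : MvPolynomial β ℚ) :
    ∃ K, ∀ b m g, g ∈ V D c m → lift (Lop q b) g ∈ V D c (m + K) := by
  choose K hK using fun b => lift_pd_V hD (pderiv b q)
  refine ⟨1 + ∑ b, K b, fun b m g hg => ?_⟩
  have : lift (Lop q b) g = PowerSeries.C (X b) * g - lift (pd (pderiv b q)) g := by
    ext1 n; rw [coeff_lift, Lop_apply, map_sub, coeff_lift, PowerSeries.coeff_C_mul]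
  rw [this]
  have hb : K b ≤ ∑ b, K b := Finset.single_le_sum (fun _ _ => Nat.zero_le _) (Finset.mem_univ b)
  exact Submodule.sub_mem _ (V_mono hD (by omega) (V_mul hg (hD' b)))
    (V_mono hD (by omega) (hK b m g hg))

theorem lift_psi_V {D : PS β} {c K : ℕ} (q : MvPolynomial β ℚ)
    (hK : ∀ b m g, g ∈ V D c m → lift (Lop q b) g ∈ V D c (m + K)) (γ : β →₀ ℕ) :
    ∀ m g, g ∈ V D c m → lift (psi q (monomial γ 1)) g ∈ V D c (m + K * γ.degree) := by
  have hmul : ∀ s t g, lift (psi q (s * t)) g = lift (psi q s) (lift (psi q t) g) := by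
    intro s t g
    ext1 n; rw [coeff_lift, map_mul, Module.End.mul_apply, coeff_lift, coeff_lift]
  have hzero : ∀ m g, g ∈ V D c m →
      lift (psi q (monomial 0 1)) g ∈ V D c (m + K * (0 : β →₀ ℕ).degree) := by
    intro m g hg
    have : (monomial 0 1 : MvPolynomial β ℚ) = 1 := rfl
    have : lift (psi q (monomial 0 1)) g = g := by
      ext1 n; rw [coeff_lift, this, map_one, Module.End.one_apply]
    rw [this]; simpa using hg
  have hadd : ∀ γ₁ γ₂ : β →₀ ℕ,
     (∀ m g, g ∈ V D c m → lift (psi q (monomial γ₁ 1)) g ∈ V D c (m + K * γ₁.degree)) →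
     (∀ m g, g ∈ V D c m → lift (psi q (monomial γ₂ 1)) g ∈ V D c (m + K * γ₂.degree)) →
     (∀ m g, g ∈ V D c m →
      lift (psi q (monomial (γ₁ + γ₂) 1)) g ∈ V D c (m + K * (γ₁ + γ₂).degree)) := by
    intro γ₁ γ₂ h₁ h₂ m g hg
    have : (monomial (γ₁ + γ₂) 1 : MvPolynomial β ℚ) = monomial γ₁ 1 * monomial γ₂ 1 := by
      simp [monomial_mul]
    rw [this, hmul]
    have := h₁ _ _ (h₂ _ _ hg)
    rwa [map_add, mul_add, add_comm (K * γ₁.degree), ← add_assoc]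
  induction γ using Finsupp.induction_linear with
  | zero => exact hzero
  | add γ₁ γ₂ h₁ h₂ => exact hadd _ _ h₁ h₂
  | single b n =>
    induction n with
    | zero => simpa only [Finsupp.single_zero] using hzero
    | succ n ih =>
      rw [Finsupp.single_add]
      refine hadd _ _ ih fun m g hg => ?_
      have : (monomial (Finsupp.single b 1) 1 : MvPolynomial β ℚ) = X b := rfl
      rw [this, psi_X]
      simpa using hK b m g hg

end GLR

namespace GLR
open MvPolynomial

variable {β : Type*} [Fintype β] [DecidableEq β]

theorem finrank_Pol_le (d : ℕ) :
    Module.finrank ℚ (Pol β d) ≤ (d + 1) ^ (Fintype.card β + 1) := by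
  refine (finrank_range_le_card _).trans ?_
  simp [pow_succ, mul_comm]

instance finite_Pol (d : ℕ) : Module.Finite ℚ (Pol β d) := by
  unfold Pol
  exact FiniteDimensional.span_of_finite ℚ (Set.finite_range _)

theorem exists_relation {D : PS β} (hD : D ≠ 0) {c m : ℕ} {ι : Type*} [Fintype ι] (v : ι → PS β)
    (hv : ∀ i, v i ∈ V D c m) (hcard : (c * m + 1) ^ (Fintype.card β + 1) < Fintype.card ι) :
    ∃ a : ι → ℚ, a ≠ 0 ∧ ∑ i, a i • v i = 0 := by
  let w : ι → Pol β (c * m) := fun i => ⟨D ^ m * v i, hv i⟩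
  have hw : ¬ LinearIndependent ℚ w := by
    intro h
    have := h.fintype_card_le_finrank
    have := finrank_Pol_le (β := β) (c * m)
    omega
  obtain ⟨a, ha, i, hi⟩ := Fintype.not_linearIndependent_iff.1 hw
  refine ⟨a, fun h => hi (by rw [h]; rfl), ?_⟩
  have h2 : ∑ i, a i • (D ^ m * v i) = 0 := by
    have := congrArg (Submodule.subtype _) ha
    simpa [w] using this
  have h3 : D ^ m * ∑ i, a i • v i = 0 := by
    rw [Finset.mul_sum, ← h2]
    exact Finset.sum_congr rfl fun i _ => by rw [mul_smul_comm]
  exact (mul_eq_zero.1 h3).resolve_left (pow_ne_zero _ hD)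

theorem holonomic_core (q : MvPolynomial β ℚ) (h0 : constantCoeff q = 0)
    (R : PS β) (Dp Np : Polynomial (MvPolynomial β ℚ)) (hD0 : Dp ≠ 0)
    (hR : (Dp : PS β) * R = Np) :
    ∃ (e : ℕ) (a : Fin e → Fin e → ℚ), a ≠ 0 ∧ ∀ n : ℕ,
      ∑ i : Fin e, ∑ j : Fin e, a i j * (if (i : ℕ) ≤ n then
        ((n - i : ℕ) : ℚ) ^ (j : ℕ) * lam q h0 (PowerSeries.coeff (n - i) R) else 0) = 0 := by
  obtain ⟨d₁, hd₁⟩ := exists_Pol Dp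
  obtain ⟨d₂, hd₂⟩ := exists_Pol Np
  set D : PS β := (Dp : PS β) with hDdef
  have hD : D ≠ 0 := by
    rw [hDdef, Ne, Polynomial.coe_eq_zero_iff]; exact hD0
  obtain ⟨c, hc⟩ : ∃ c, c = d₁ + d₂ + 1 := ⟨_, rfl⟩
  have hDc : D ∈ Pol β c := Pol_mono (by omega) hd₁
  have hX : (PowerSeries.X : PS β) * D ∈ Pol β c := by
    have h1 : (PowerSeries.X : PS β) = gen 1 0 := by
      rw [gen, PowerSeries.X_eq]; rfl
    rw [h1]
    exact Pol_mono (by omega) (Pol_mul (gen_mem (d := 1) le_rfl (by simp)) hd₁)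
  have hT : ∀ b, PowerSeries.C (X b) * D ∈ Pol β c := by
    intro b
    have h1 : (PowerSeries.C (X b) : PS β) = gen 0 (Finsupp.single b 1) := by
      rw [gen, ← PowerSeries.monomial_zero_eq_C_apply]; rfl
    rw [h1]
    refine Pol_mono (by omega) (Pol_mul (gen_mem (d := 1) (by omega) ?_) hd₁)
    intro b'; rw [Finsupp.single_apply]; split <;> omega
  have hRV : R ∈ V D c 1 := by
    rw [mem_V, pow_one, hR]
    exact Pol_mono (by omega) hd₂
  obtain ⟨K, hK⟩ := lift_Lop_V hDc hT q
  obtain ⟨N, hN⟩ : ∃ N, N = Fintype.card β := ⟨_, rfl⟩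
  obtain ⟨H, hH⟩ : ∃ H, H = c * (3 + K * N) + 1 := ⟨_, rfl⟩
  obtain ⟨e, he⟩ : ∃ e, e = H ^ (N + 1) + 1 := ⟨_, rfl⟩
  let fs : (β → Fin e) → (β →₀ ℕ) := fun γ => Finsupp.equivFunOnFinite.symm fun b => (γ b : ℕ)
  have fs_inj : Function.Injective fs := by
    intro γ γ' h
    have := Finsupp.equivFunOnFinite.symm.injective h
    funext b
    exact Fin.ext (congrFun this b)
  let v : Fin e × Fin e × (β → Fin e) → PS β := fun x =>
    PowerSeries.X ^ (x.1 : ℕ) * ((theta ^ (x.2.1 : ℕ)) (lift (psi q (monomial (fs x.2.2) 1)) R))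
  have hv : ∀ x, v x ∈ V D c (e * (3 + K * N)) := by
    intro x
    have hdeg : (fs x.2.2).degree ≤ N * e := by
      rw [Finsupp.degree_eq_sum, hN, ← Finset.card_univ, ← smul_eq_mul]
      exact Finset.sum_le_card_nsmul _ _ _ fun b _ => (x.2.2 b).2.le
    have s1 := lift_psi_V q hK (fs x.2.2) 1 R hRV
    have s2 : ∀ j m (g : PS β), g ∈ V D c m → (theta ^ j) g ∈ V D c (m + j) := by
      intro j
      induction j with
      | zero => intro m g hg; simpa using hg
      | succ j ih =>
        intro m g hg
        rw [pow_succ, Module.End.mul_apply]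
        have := ih _ _ (V_der theta theta_mul (fun d F hF => theta_Pol hF) hDc hg)
        rwa [add_assoc, add_comm 1] at this
    have s3 : ∀ j m (g : PS β), g ∈ V D c m → PowerSeries.X ^ j * g ∈ V D c (m + j) := by
      intro j
      induction j with
      | zero => intro m g hg; simpa using hg
      | succ j ih =>
        intro m g hg
        rw [pow_succ, mul_assoc]
        have := ih _ _ (V_mul hg hX)
        rwa [add_assoc, add_comm 1] at this
    refine V_mono hDc ?_ (s3 _ _ _ (s2 _ _ _ s1))
    have h1 := x.1.2
    have h2 := x.2.1.2
    have h3 : K * (fs x.2.2).degree ≤ K * (N * e) := Nat.mul_le_mul_left _ hdeg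
    have h4 : e * (3 + K * N) = 3 * e + K * (N * e) := by ring
    omega
  have hcard : (c * (e * (3 + K * N)) + 1) ^ (Fintype.card β + 1) <
      Fintype.card (Fin e × Fin e × (β → Fin e)) := by
    have h1 : Fintype.card (Fin e × Fin e × (β → Fin e)) = e ^ (N + 1) * e := by
      simp [← hN]; ring
    have h2 : c * (e * (3 + K * N)) + 1 ≤ H * e := by
      have : H * e = c * (e * (3 + K * N)) + e := by rw [hH]; ring
      omega
    rw [h1, ← hN]
    calc _ ≤ (H * e) ^ (N + 1) := Nat.pow_le_pow_left h2 _
      _ = e ^ (N + 1) * H ^ (N + 1) := by rw [mul_pow, mul_comm]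
      _ < e ^ (N + 1) * e := by
        apply Nat.mul_lt_mul_of_pos_left
        · omega
        · apply Nat.pow_pos; omega
  obtain ⟨a, ha, hrel⟩ := exists_relation hD v hv hcard
  -- minimal exponent
  have hex : ∃ x : Fin e × Fin e × (β → Fin e), a x ≠ 0 := by
    by_contra h; push Not at h; exact ha (funext h)
  obtain ⟨x₀, hx₀, hmin⟩ : ∃ x₀, a x₀ ≠ 0 ∧ ∀ x, a x ≠ 0 → (fs x₀.2.2).degree ≤ (fs x.2.2).degree := by
    obtain ⟨x₀, hx₀, hmin⟩ := Finset.exists_min_image (Finset.univ.filter fun x => a x ≠ 0)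
      (fun x => (fs x.2.2).degree) (by
        obtain ⟨x, hx⟩ := hex
        exact ⟨x, by simpa using hx⟩)
    exact ⟨x₀, by simpa using hx₀, fun x hx => hmin x (by simpa using hx)⟩
  obtain ⟨N₀, hN₀, hN₀'⟩ := pd_monomial (fs x₀.2.2) (fs x₀.2.2)
  have hN₀ne : N₀ ≠ 0 := hN₀'.1 le_rfl
  have hpd : ∀ x, a x ≠ 0 → x.2.2 ≠ x₀.2.2 →
      pd (monomial (fs x.2.2) 1) (monomial (fs x₀.2.2) 1) = 0 := by
    intro x hx hne
    obtain ⟨N₁, h1, h1'⟩ := pd_monomial (fs x.2.2) (fs x₀.2.2)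
    have : N₁ = 0 := by
      by_contra h
      have hle := h1'.2 h
      have hdeg := hmin x hx
      apply hne
      apply fs_inj
      obtain ⟨r, hr⟩ := exists_add_of_le hle
      rw [hr, map_add] at hdeg
      have : r.degree = 0 := by omega
      rw [Finsupp.degree_eq_zero_iff] at this
      rw [hr, this, add_zero]
    rw [h1, this, monomial_zero]
  refine ⟨e, fun i j => a (i, j, x₀.2.2), ?_, ?_⟩
  · intro h
    exact hx₀ (congrFun (congrFun h x₀.1) x₀.2.1)
  intro n
  have h1 := congrArg (fun F => lam q h0 (pd (monomial (fs x₀.2.2) 1) (PowerSeries.coeff n F))) hrel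
  simp only [map_sum, map_zero] at h1
  have hterm : ∀ x : Fin e × Fin e × (β → Fin e),
      lam q h0 (pd (monomial (fs x₀.2.2) 1) (PowerSeries.coeff n (a x • v x))) =
      if x.2.2 = x₀.2.2 then N₀ * (a x * (if (x.1 : ℕ) ≤ n then
        ((n - x.1 : ℕ) : ℚ) ^ (x.2.1 : ℕ) * lam q h0 (PowerSeries.coeff (n - x.1) R) else 0)) else 0 := by
    intro x
    rw [coeff_qsmul, map_smul, map_smul, smul_eq_mul]
    by_cases hax : a x = 0
    · simp [hax]
    simp only [v]
    rw [PowerSeries.coeff_X_pow_mul']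
    by_cases hxn : (x.1 : ℕ) ≤ n
    · rw [if_pos hxn, if_pos hxn, coeff_theta_pow, coeff_lift, map_smul, map_smul, smul_eq_mul,
        lam_pd_psi]
      by_cases hxx : x.2.2 = x₀.2.2
      · rw [if_pos hxx, hxx, hN₀, tsub_self]
        have : (monomial 0 N₀ : MvPolynomial β ℚ) = C N₀ := rfl
        rw [this, pd_C, map_smul, smul_eq_mul]
        ring
      · rw [if_neg hxx, hpd x hax hxx, map_zero]; simp
    · rw [if_neg hxn, if_neg hxn]; simp
  rw [Finset.sum_congr rfl fun x _ => hterm x] at h1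
  rw [Fintype.sum_prod_type] at h1
  simp only [Fintype.sum_prod_type, Finset.sum_ite_eq', Finset.sum_ite_eq, Finset.mem_univ,
    if_true, ← Finset.mul_sum] at h1
  exact (mul_eq_zero.1 h1).resolve_left hN₀ne

/-- Conversion into a recurrence. -/
theorem recurrence_of_core (s : ℕ → ℚ) (e : ℕ) (a : Fin e → Fin e → ℚ) (ha : a ≠ 0)
    (h : ∀ n : ℕ, ∑ i : Fin e, ∑ j : Fin e, a i j * (if (i : ℕ) ≤ n then
        ((n - i : ℕ) : ℚ) ^ (j : ℕ) * s (n - i) else 0) = 0) :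
    ∃ (d : ℕ) (p : ℕ → Polynomial ℚ),
      (∃ i ≤ d, p i ≠ 0) ∧
      ∃ N : ℕ, ∀ n ≥ N,
        ∑ i ∈ Finset.range (d + 1), (p i).eval (n : ℚ) * s (n + i) = 0 := by
  have hex : ∃ i j, a i j ≠ 0 := by
    by_contra h; push Not at h; exact ha (by funext i j; exact h i j)
  obtain ⟨i₀, j₀, h₀⟩ := hex
  obtain ⟨d, rfl⟩ : ∃ d, e = d + 1 := ⟨e - 1, by have := i₀.2; omega⟩
  -- `P i = ∑ j a (d - i) j X^j`
  let P : Fin (d + 1) → Polynomial ℚ := fun i => ∑ j : Fin (d + 1), Polynomial.monomial (j : ℕ) (a (Fin.rev i) j)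
  refine ⟨d, fun i => if hi : i < d + 1 then (P ⟨i, hi⟩).comp (Polynomial.X + Polynomial.C (i : ℚ)) else 0,
    ⟨(Fin.rev i₀ : ℕ), by have := (Fin.rev i₀).2; omega, ?_⟩, 0, ?_⟩
  · simp only [Fin.is_lt, dif_pos]
    intro hz
    have hP : P (Fin.rev i₀) = 0 := by
      rw [Polynomial.comp_eq_zero_iff] at hz
      rcases hz with hz | hz
      · exact hz
      · exfalso
        have := congrArg (fun p => Polynomial.coeff p 1) hz.2
        simp at this
    have := congrArg (fun p => Polynomial.coeff p (j₀ : ℕ)) hP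
    simp only [P, Fin.rev_rev, Polynomial.finset_sum_coeff, Polynomial.coeff_monomial,
      Polynomial.coeff_zero, Fin.val_inj, Finset.sum_ite_eq', Finset.mem_univ, if_true] at this
    exact h₀ this
  · intro n _
    have := h (n + d)
    rw [Finset.sum_range, ← Equiv.sum_comp Fin.revPerm, ← this]
    refine Finset.sum_congr rfl fun i _ => ?_
    have hi := i.2
    have e1 : n + d - (i : ℕ) = n + (Fin.rev i : ℕ) := by simp [Fin.val_rev]; omega
    simp only [Fin.revPerm_apply, Fin.is_lt, dif_pos, Fin.eta, e1, if_pos (show (i : ℕ) ≤ n + d by omega),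
      Polynomial.eval_comp, P, Polynomial.eval_finset_sum, Polynomial.eval_monomial, Fin.rev_rev,
      Finset.sum_mul]
    refine Finset.sum_congr rfl fun j _ => ?_
    simp
    ring
end GLR

namespace GLR
open MvPolynomial
open scoped Classical in
/-- The tiling polynomial of the finite set `C` of cells by the placed blocks `PB`. -/
noncomputable def rp {α β : Type*} [LinearOrder α] [Fintype β] (PB : β → Finset α → Prop)
    (C : Finset α) : MvPolynomial β ℚ :=
  if h : C.Nonempty then
    ∑ b : β, ∑ B ∈ (C.powerset.filter fun B => C.min' h ∈ B ∧ PB b B).attach, X b * rp PB (C \ B.1)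
  else 1
termination_by C.card
decreasing_by
  have hB := B.2
  simp only [Finset.mem_filter, Finset.mem_powerset] at hB
  exact Finset.card_lt_card (Finset.sdiff_ssubset hB.1 ⟨_, hB.2.1⟩)

variable {α β : Type*} [LinearOrder α] [Fintype β] (PB : β → Finset α → Prop)

theorem rp_empty : rp PB ∅ = 1 := by
  rw [rp]; simp

open scoped Classical in
theorem rp_eq (C : Finset α) (h : C.Nonempty) :
    rp PB C = ∑ b : β, ∑ B ∈ C.powerset.filter (fun B => C.min' h ∈ B ∧ PB b B),
      X b * rp PB (C \ B) := by
  rw [rp, dif_pos h]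
  refine Finset.sum_congr rfl fun b _ => ?_
  exact Finset.sum_attach _ fun B => X b * rp PB (C \ B)

theorem constantCoeff_rp (C : Finset α) : constantCoeff (rp PB C) = if C = ∅ then 1 else 0 := by
  classical
  split
  · subst C; rw [rp_empty, map_one]
  · rename_i h
    rw [rp_eq PB C (Finset.nonempty_iff_ne_empty.2 h)]
    simp

open scoped Classical in
theorem pderiv_rp (hne : ∀ b B, PB b B → B.Nonempty) (b : β) (C : Finset α) :
    pderiv b (rp PB C) = ∑ B ∈ C.powerset.filter (fun B => PB b B), rp PB (C \ B) := by
  induction C using Finset.strongInduction with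
  | H C ih =>
  by_cases h : C.Nonempty
  swap
  · rw [Finset.not_nonempty_iff_eq_empty] at h
    subst h
    rw [rp_empty, Derivation.map_one_eq_zero, Finset.sum_eq_zero]
    intro B hB
    simp only [Finset.powerset_empty, Finset.mem_filter, Finset.mem_singleton] at hB
    have := hne _ _ hB.2
    simp [hB.1] at this
  set z := C.min' h with hz
  rw [rp_eq PB C h, ← hz]
  simp only [map_sum, Derivation.leibniz, smul_eq_mul, pderiv_X, Finset.sum_add_distrib]
  rw [← Finset.sum_filter_add_sum_filter_not (C.powerset.filter fun B => PB b B) (fun B => z ∈ B),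
    add_comm]
  congr 1
  · rw [Finset.sum_eq_single b]
    · rw [Finset.filter_filter]
      refine Finset.sum_congr (Finset.filter_congr fun B _ => and_comm) fun B _ => ?_
      simp
    · intro b' _ hb
      refine Finset.sum_eq_zero fun B _ => ?_
      rw [Pi.single_eq_of_ne (by first | exact hb | exact hb.symm), mul_zero]
    · simp
  · have e1 : ∀ B ∈ (C.powerset.filter fun B => PB b B).filter (fun B => ¬ z ∈ B),
        rp PB (C \ B) = ∑ b' : β, ∑ B' ∈ (C \ B).powerset.filter (fun B' => z ∈ B' ∧ PB b' B'),
          X b' * rp PB ((C \ B) \ B') := by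
      intro B hB
      simp only [Finset.mem_filter, Finset.mem_powerset] at hB
      have hzC : z ∈ C \ B := Finset.mem_sdiff.2 ⟨Finset.min'_mem _ _, hB.2⟩
      have hmin : (C \ B).min' ⟨z, hzC⟩ = z := by
        apply le_antisymm
        · exact Finset.min'_le _ _ hzC
        · exact Finset.min'_subset ⟨z, hzC⟩ Finset.sdiff_subset
      rw [rp_eq PB (C \ B) ⟨z, hzC⟩, hmin]
    rw [Finset.sum_congr rfl e1, Finset.sum_comm]
    refine Finset.sum_congr rfl fun b' _ => ?_
    have e2 : ∀ B' ∈ C.powerset.filter (fun B' => z ∈ B' ∧ PB b' B'),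
        X b' * pderiv b (rp PB (C \ B')) =
        ∑ B ∈ (C \ B').powerset.filter (fun B => PB b B), X b' * rp PB ((C \ B) \ B') := by
      intro B' hB'
      simp only [Finset.mem_filter, Finset.mem_powerset] at hB'
      rw [ih _ (Finset.sdiff_ssubset hB'.1 ⟨_, hB'.2.1⟩), Finset.mul_sum]
      refine Finset.sum_congr rfl fun B _ => ?_
      rw [sdiff_right_comm]
    rw [Finset.sum_congr rfl e2]
    refine Finset.sum_comm' ?_
    intro B' B
    simp only [Finset.mem_filter, Finset.mem_powerset, Finset.subset_sdiff]
    constructor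
    · rintro ⟨⟨h1, h2, h3⟩, ⟨h4, h5⟩, h6⟩
      refine ⟨⟨⟨h1, h5.symm⟩, h2, h3⟩, ⟨h4, h6⟩, fun hzB => ?_⟩
      exact Finset.disjoint_left.1 h5 hzB h2
    · rintro ⟨⟨⟨h1, h5⟩, h2, h3⟩, ⟨h4, h6⟩, h7⟩
      exact ⟨⟨h1, h2, h3⟩, ⟨h4, h5.symm⟩, h6⟩

end GLR

namespace GLR
open MvPolynomial

/-- A type: a class label for every row, and a displacement. -/
abbrev Ty (k : ℕ) := (Fin k → Fin k) × (Fin k → ℤ)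

def chi {k : ℕ} (T : Ty k) (j : Fin k → ℤ) : Prop := ∃ p : Fin k → ℤ, ∀ i, j i = p (T.1 i) + T.2 i

open scoped Classical in
noncomputable def ind {k : ℕ} (T : Ty k) (j : Fin k → ℤ) : ℚ := if chi T j then 1 else 0

open scoped Classical in
theorem ind_mul {k : ℕ} (T : Ty k) (i i' : Fin k) (s : ℤ) :
    (fun j => ind T j * (if j i' - j i = s then 1 else 0)) ∈
      Submodule.span ℚ (Set.range (ind (k := k))) := by
  by_cases h : T.1 i = T.1 i'
  · by_cases hs : T.2 i' - T.2 i = s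
    · have : (fun j => ind T j * (if j i' - j i = s then 1 else 0)) = ind T := by
        funext j
        by_cases hc : chi T j
        · obtain ⟨p, hp⟩ := id hc
          rw [if_pos, mul_one]
          rw [hp, hp, h, ← hs]; ring
        · simp [ind, hc]
      rw [this]
      exact Submodule.subset_span ⟨T, rfl⟩
    · have : (fun j => ind T j * (if j i' - j i = s then 1 else 0)) = 0 := by
        funext j
        by_cases hc : chi T j
        · obtain ⟨p, hp⟩ := id hc
          rw [if_neg, mul_zero]; rfl
          intro h2
          apply hs
          rw [hp, hp, h] at h2; rw [← h2]; ring
        · simp [ind, hc]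
      rw [this]
      exact Submodule.zero_mem _
  · let T' : Ty k := (fun x => if T.1 x = T.1 i' then T.1 i else T.1 x,
      fun x => if T.1 x = T.1 i' then T.2 x + (T.2 i + s - T.2 i') else T.2 x)
    have : (fun j => ind T j * (if j i' - j i = s then 1 else 0)) = ind T' := by
      funext j
      have key : chi T' j ↔ chi T j ∧ j i' - j i = s := by
        constructor
        · rintro ⟨p, hp⟩
          refine ⟨⟨fun l => if l = T.1 i' then p (T.1 i) + (T.2 i + s - T.2 i') else p l, ?_⟩, ?_⟩
          · intro x
            rw [hp x]
            by_cases hx : T.1 x = T.1 i'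
            · simp [T', hx]; ring
            · simp [T', hx]
          · rw [hp i, hp i']
            simp [T', h]
        · rintro ⟨⟨p, hp⟩, hs⟩
          refine ⟨p, fun x => ?_⟩
          by_cases hx : T.1 x = T.1 i'
          · simp [T', hx]
            rw [hp x, hx]
            rw [hp i, hp i'] at hs
            linarith
          · simp [T', hx, hp x]
      unfold ind
      by_cases h1 : chi T j <;> by_cases h2 : j i' - j i = s <;> simp [key, h1, h2]
    rw [this]
    exact Submodule.subset_span ⟨T', rfl⟩

open scoped Classical in
theorem span_mul {k : ℕ} (f : (Fin k → ℤ) → ℚ) (hf : f ∈ Submodule.span ℚ (Set.range (ind (k := k))))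
    (i i' : Fin k) (s : ℤ) :
    (fun j => f j * (if j i' - j i = s then 1 else 0)) ∈
      Submodule.span ℚ (Set.range (ind (k := k))) := by
  induction hf using Submodule.span_induction with
  | mem x hx => obtain ⟨T, rfl⟩ := hx; exact ind_mul T i i' s
  | zero => convert Submodule.zero_mem _ using 1; funext j; simp
  | add x y _ _ hx hy =>
    convert Submodule.add_mem _ hx hy using 1; funext j; simp only [Pi.add_apply, add_mul]
  | smul a x _ hx =>
    convert Submodule.smul_mem _ a hx using 1; funext j; simp

/-- the tuple of positions avoids the forbidden differences -/
def Good {k : ℕ} (S : Fin k → Fin k → Finset ℤ) (j : Fin k → ℤ) : Prop :=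
  ∀ i i' : Fin k, i < i' → j i' - j i ∉ S i i'

open scoped Classical in
theorem exists_types {k : ℕ} (S : Fin k → Fin k → Finset ℤ) :
    ∃ c : Ty k →₀ ℚ, ∀ j : Fin k → ℤ,
      (∑ T ∈ c.support, c T * (if chi T j then 1 else 0)) = if Good S j then 1 else 0 := by
  have key : ∀ P : Finset (Σ _ : Fin k × Fin k, ℤ),
      (fun j : Fin k → ℤ => if ∀ t ∈ P, j t.1.2 - j t.1.1 ≠ t.2 then (1 : ℚ) else 0) ∈
      Submodule.span ℚ (Set.range (ind (k := k))) := by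
    intro P
    induction P using Finset.induction_on with
    | empty =>
      have : (fun j : Fin k → ℤ => if ∀ t ∈ (∅ : Finset (Σ _ : Fin k × Fin k, ℤ)),
          j t.1.2 - j t.1.1 ≠ t.2 then (1 : ℚ) else 0) = ind ((id, 0) : Ty k) := by
        funext j
        have : chi ((id, 0) : Ty k) j := ⟨j, fun i => by simp⟩
        simp [ind, this]
      rw [this]
      exact Submodule.subset_span ⟨_, rfl⟩
    | insert t P ht ih =>
      convert Submodule.sub_mem _ ih (span_mul _ ih t.1.1 t.1.2 t.2) using 1
      funext j
      simp only [Finset.forall_mem_insert, Pi.sub_apply]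
      by_cases h1 : j t.1.2 - j t.1.1 = t.2 <;>
        by_cases h2 : ∀ t ∈ P, j t.1.2 - j t.1.1 ≠ t.2 <;> simp [h1, h2]
  have := key (((Finset.univ : Finset (Fin k × Fin k)).filter fun x => x.1 < x.2).sigma
    fun x => S x.1 x.2)
  rw [Finsupp.mem_span_range_iff_exists_finsupp] at this
  obtain ⟨c, hc⟩ := this
  refine ⟨c, fun j => ?_⟩
  have := congrFun hc j
  rw [Finsupp.sum, Finset.sum_apply] at this
  simp only [Pi.smul_apply, smul_eq_mul, ind] at this
  rw [this]
  congr 1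
  apply propext
  simp only [Good, Finset.mem_sigma, Finset.mem_filter, Finset.mem_univ, true_and]
  constructor
  · intro h i i' hi hs
    exact h ⟨(i, i'), j i' - j i⟩ ⟨hi, hs⟩ rfl
  · rintro h ⟨⟨i, i'⟩, s⟩ ⟨hi, hs⟩ h2
    exact h i i' hi (h2 ▸ hs)

/-- Cells, ordered by column first. -/
abbrev Cell (k : ℕ) := ℤ ×ₗ Fin k

def cell {k : ℕ} (i : Fin k) (x : ℤ) : Cell k := toLex (x, i)

theorem cell_inj {k : ℕ} {i i' : Fin k} {x x' : ℤ} : cell i x = cell i' x' ↔ i = i' ∧ x = x' := by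
  simp [cell, and_comm]

def row {k : ℕ} (x : Cell k) : Fin k := (ofLex x).2
def col {k : ℕ} (x : Cell k) : ℤ := (ofLex x).1

@[simp] theorem row_cell {k : ℕ} (i : Fin k) (x : ℤ) : row (cell i x) = i := rfl
@[simp] theorem col_cell {k : ℕ} (i : Fin k) (x : ℤ) : col (cell i x) = x := rfl
@[simp] theorem cell_row_col {k : ℕ} (x : Cell k) : cell (row x) (col x) = x := rfl

/-- The block with label `l` placed at `p`. -/
def blk {k : ℕ} (T : Ty k) (l : Fin k) (p : ℤ) : Finset (Cell k) :=
  (Finset.univ.filter fun i => T.1 i = l).image fun i => cell i (p + T.2 i)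

theorem mem_blk {k : ℕ} {T : Ty k} {l : Fin k} {p : ℤ} {x : Cell k} :
    x ∈ blk T l p ↔ T.1 (row x) = l ∧ col x = p + T.2 (row x) := by
  simp only [blk, Finset.mem_image, Finset.mem_filter, Finset.mem_univ, true_and]
  constructor
  · rintro ⟨i, h, rfl⟩; simp [h]
  · rintro ⟨h1, h2⟩; exact ⟨row x, h1, by rw [← h2]; simp⟩

def PBk {k : ℕ} (𝒯 : Finset (Ty k)) (b : 𝒯 × Fin k) (B : Finset (Cell k)) : Prop :=
  (∃ i, b.1.1.1 i = b.2) ∧ ∃ p, B = blk b.1.1 b.2 p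

theorem PBk_nonempty {k : ℕ} (𝒯 : Finset (Ty k)) (b : 𝒯 × Fin k) (B : Finset (Cell k))
    (h : PBk 𝒯 b B) : B.Nonempty := by
  obtain ⟨⟨i, hi⟩, p, rfl⟩ := h
  exact ⟨cell i (p + b.1.1.2 i), mem_blk.2 (by simp [hi])⟩

def graph {k : ℕ} (j : Fin k → ℤ) : Finset (Cell k) := Finset.univ.image fun i => cell i (j i)

theorem mem_graph {k : ℕ} {j : Fin k → ℤ} {x : Cell k} : x ∈ graph j ↔ col x = j (row x) := by
  simp only [graph, Finset.mem_image, Finset.mem_univ, true_and]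
  constructor
  · rintro ⟨i, rfl⟩; simp
  · intro h; exact ⟨row x, by rw [← h]; simp⟩

theorem graph_inj {k : ℕ} {j j' : Fin k → ℤ} (h : graph j = graph j') : j = j' := by
  funext i
  have : cell i (j i) ∈ graph j' := by rw [← h]; exact mem_graph.2 rfl
  exact mem_graph.1 this

theorem card_graph {k : ℕ} (j : Fin k → ℤ) : (graph j).card = k := by
  rw [graph, Finset.card_image_of_injective, Finset.card_univ, Fintype.card_fin]
  intro i i' h
  exact (cell_inj.1 h).1

/-- partial union of blocks -/
def PI {k : ℕ} (T : Ty k) (I : Finset (Fin k)) (B : Finset (Cell k)) : Prop :=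
  ∃ p : Fin k → ℤ, ∀ x, x ∈ B ↔ T.1 (row x) ∈ I ∧ col x = p (T.1 (row x)) + T.2 (row x)

open scoped Classical in
theorem pd_prod_rp {k : ℕ} (𝒯 : Finset (Ty k)) (T : 𝒯) (I : Finset (Fin k))
    (hI : ∀ l ∈ I, ∃ i, T.1.1 i = l) (C : Finset (Cell k)) :
    pd (∏ l ∈ I, X (T, l)) (rp (PBk 𝒯) C) =
      ∑ B ∈ C.powerset.filter (fun B => PI T.1 I B), rp (PBk 𝒯) (C \ B) := by
  induction I using Finset.induction_on with
  | empty =>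
    have : C.powerset.filter (fun B => PI T.1 ∅ B) = {∅} := by
      ext B
      simp only [PI, Finset.mem_filter, Finset.mem_powerset, Finset.notMem_empty, false_and,
        iff_false, Finset.mem_singleton, exists_const]
      constructor
      · rintro ⟨_, h⟩; exact Finset.eq_empty_of_forall_notMem h
      · rintro rfl; simp
    rw [this]; simp
  | insert l I hl ih =>
    rw [Finset.prod_insert hl, pd_mul, ih fun l' h' => hI l' (Finset.mem_insert_of_mem h'), pd_X,
      map_sum]
    simp only [pderiv_rp (PBk 𝒯) (PBk_nonempty 𝒯)]
    rw [Finset.sum_sigma']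
    refine Finset.sum_bij' (fun x _ => x.1 ∪ x.2)
      (fun B _ => ⟨B.filter fun x => T.1.1 (row x) ∈ I, B.filter fun x => T.1.1 (row x) = l⟩)
      ?_ ?_ ?_ ?_ ?_
    · rintro ⟨B, B'⟩ h
      simp only [Finset.mem_sigma, Finset.mem_filter, Finset.mem_powerset, Finset.subset_sdiff] at h ⊢
      obtain ⟨⟨h1, p, hp⟩, ⟨h2, h3⟩, -, p', rfl⟩ := h
      refine ⟨Finset.union_subset h1 h2, Function.update p l p', fun x => ?_⟩
      rw [Finset.mem_union, hp, mem_blk, Finset.mem_insert]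
      by_cases hx : T.1.1 (row x) = l
      · simp [hx, hl]
      · simp [hx]
    · intro B h
      simp only [Finset.mem_sigma, Finset.mem_filter, Finset.mem_powerset, Finset.subset_sdiff] at h ⊢
      obtain ⟨h1, p, hp⟩ := h
      refine ⟨⟨(Finset.filter_subset _ _).trans h1, p, fun x => ?_⟩,
        ⟨(Finset.filter_subset _ _).trans h1, ?_⟩, hI l (Finset.mem_insert_self _ _), p l, ?_⟩
      · rw [Finset.mem_filter, hp, Finset.mem_insert]; tauto
      · rw [Finset.disjoint_left]
        intro x hx hx'
        rw [Finset.mem_filter] at hx hx'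
        exact hl (hx.2 ▸ hx'.2)
      · ext x
        rw [Finset.mem_filter, hp, Finset.mem_insert, mem_blk]
        constructor
        · rintro ⟨⟨_, h⟩, h'⟩; rw [h'] at h; exact ⟨h', h⟩
        · rintro ⟨h', h⟩; rw [h']; exact ⟨⟨Or.inl rfl, h⟩, rfl⟩
    · rintro ⟨B, B'⟩ h
      simp only [Finset.mem_sigma, Finset.mem_filter, Finset.mem_powerset, Finset.subset_sdiff] at h ⊢
      obtain ⟨⟨h1, p, hp⟩, ⟨h2, h3⟩, -, p', rfl⟩ := h
      congr 1
      · ext x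
        rw [Finset.mem_filter, Finset.mem_union, hp, mem_blk]
        constructor
        · rintro ⟨h | h, h'⟩
          · exact h
          · exact absurd ((show T.1.1 (row x) = l from h.1) ▸ h') hl
        · intro h; exact ⟨Or.inl h, h.1⟩
      · ext x
        rw [Finset.mem_filter, Finset.mem_union, hp, mem_blk]
        constructor
        · rintro ⟨h | h, h'⟩
          · exact absurd (h' ▸ h.1) hl
          · exact h
        · intro h; exact ⟨Or.inr h, h.1⟩
    · intro B h
      simp only [Finset.mem_filter, Finset.mem_powerset] at h
      obtain ⟨h1, p, hp⟩ := h
      ext x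
      simp only [Finset.mem_union, Finset.mem_filter]
      have := hp x
      rw [Finset.mem_insert] at this
      tauto
    · rintro ⟨B, B'⟩ h
      rw [sdiff_sdiff_left]; rfl

theorem PI_image {k : ℕ} (T : Ty k) (B : Finset (Cell k)) :
    PI T (Finset.univ.image T.1) B ↔ ∃ j, chi T j ∧ B = graph j := by
  constructor
  · rintro ⟨p, hp⟩
    refine ⟨fun i => p (T.1 i) + T.2 i, ⟨p, fun i => rfl⟩, ?_⟩
    ext x
    rw [hp, mem_graph]
    simp
  · rintro ⟨j, ⟨p, hp⟩, rfl⟩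
    refine ⟨p, fun x => ?_⟩
    rw [mem_graph, hp]
    simp

/-- The polynomial `q`. -/
noncomputable def qpoly {k : ℕ} (c : Ty k →₀ ℚ) : MvPolynomial (c.support × Fin k) ℚ :=
  ∑ T : c.support, C (c T.1) * ∏ l ∈ Finset.univ.image T.1.1, X (T, l)

theorem qpoly_const {k : ℕ} (hk : 1 ≤ k) (c : Ty k →₀ ℚ) : constantCoeff (qpoly c) = 0 := by
  rw [qpoly, map_sum]
  refine Finset.sum_eq_zero fun T _ => ?_
  rw [map_mul, map_prod]
  have : T.1.1 ⟨0, hk⟩ ∈ Finset.univ.image T.1.1 := Finset.mem_image_of_mem _ (Finset.mem_univ _)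
  rw [Finset.prod_eq_zero this (by simp), mul_zero]

open scoped Classical in
/-- The weight of a set of cells. -/
noncomputable def omg {k : ℕ} (S : Fin k → Fin k → Finset ℤ) (B : Finset (Cell k)) : ℚ :=
  if ∃ j, Good S j ∧ B = graph j then 1 else 0

theorem pd_qpoly_rp {k : ℕ} (S : Fin k → Fin k → Finset ℤ) (c : Ty k →₀ ℚ)
    (hc : ∀ j : Fin k → ℤ, (∑ T ∈ c.support, c T * (open scoped Classical in if chi T j then 1 else 0))
      = (open scoped Classical in if Good S j then 1 else 0))
    (Cs : Finset (Cell k)) :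
    pd (qpoly c) (rp (PBk c.support) Cs) =
      ∑ B ∈ Cs.powerset, omg S B • rp (PBk c.support) (Cs \ B) := by
  classical
  rw [qpoly, map_sum, LinearMap.sum_apply]
  have e1 : ∀ T : c.support, pd (C (c T.1) * ∏ l ∈ Finset.univ.image T.1.1, X (T, l))
      (rp (PBk c.support) Cs) = ∑ B ∈ Cs.powerset,
        (c T.1 * (if ∃ j, chi T.1 j ∧ B = graph j then 1 else 0)) • rp (PBk c.support) (Cs \ B) := by
    intro T
    rw [pd_mul, pd_C, pd_prod_rp _ _ _ (by simp), Finset.sum_filter, Finset.smul_sum]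
    refine Finset.sum_congr rfl fun B _ => ?_
    rw [mul_smul]
    congr 1
    simp only [PI_image]
    split <;> simp
  rw [Finset.sum_congr rfl fun T _ => e1 T, Finset.sum_comm]
  refine Finset.sum_congr rfl fun B _ => ?_
  rw [← Finset.sum_smul]
  congr 1
  rw [Finset.sum_coe_sort c.support fun T => c T * (if ∃ j, chi T j ∧ B = graph j then (1 : ℚ) else 0)]
  by_cases hB : ∃ j, B = graph j
  · obtain ⟨j, rfl⟩ := hB
    have e2 : ∀ P : (Fin k → ℤ) → Prop, (∃ j', P j' ∧ graph j = graph j') ↔ P j := fun P =>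
      ⟨fun ⟨j', h, h'⟩ => by rw [graph_inj h']; exact h, fun h => ⟨j, h, rfl⟩⟩
    simp only [omg, e2]
    convert hc j
  · have e2 : ∀ P : (Fin k → ℤ) → Prop, ¬ (∃ j', P j' ∧ B = graph j') := fun P ⟨j', h, h'⟩ =>
      hB ⟨j', h'⟩
    simp only [omg, e2, if_false, mul_zero, Finset.sum_const_zero]

noncomputable def Wn {k : ℕ} (S : Fin k → Fin k → Finset ℤ) : ℕ → Finset (Cell k) → ℚ
  | 0, C => if C = ∅ then 1 else 0
  | n + 1, C => ∑ B ∈ C.powerset, omg S B * Wn S n (C \ B)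

theorem constantCoeff_pd_pow {k : ℕ} (S : Fin k → Fin k → Finset ℤ) (c : Ty k →₀ ℚ)
    (hc : ∀ j : Fin k → ℤ, (∑ T ∈ c.support, c T * (open scoped Classical in if chi T j then 1 else 0))
      = (open scoped Classical in if Good S j then 1 else 0)) (n : ℕ) :
    ∀ (Cs : Finset (Cell k)),
    constantCoeff (pd (qpoly c ^ n) (rp (PBk c.support) Cs)) = Wn S n Cs := by
  induction n with
  | zero => intro Cs; rw [pow_zero, map_one, Module.End.one_apply, constantCoeff_rp]; rfl
  | succ n ih =>
    intro Cs
    rw [pow_succ, pd_mul, pd_qpoly_rp S c hc, map_sum, map_sum, Wn]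
    refine Finset.sum_congr rfl fun B _ => ?_
    rw [map_smul, smul_eq_C_mul, map_mul, constantCoeff_C, ih]

theorem Wn_eq_zero {k : ℕ} (S : Fin k → Fin k → Finset ℤ) (n : ℕ) :
    ∀ (Cs : Finset (Cell k)), Cs.card ≠ k * n → Wn S n Cs = 0 := by
  induction n with
  | zero =>
    intro Cs h
    rw [Wn, if_neg]
    rintro rfl; simp at h
  | succ n ih =>
    intro Cs h
    rw [Wn]
    refine Finset.sum_eq_zero fun B hB => ?_
    rw [Finset.mem_powerset] at hB
    by_cases hg : ∃ j, Good S j ∧ B = graph j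
    · rw [ih, mul_zero]
      obtain ⟨j, -, rfl⟩ := hg
      have h1 := Finset.card_sdiff_add_card_eq_card hB
      rw [card_graph] at h1
      intro h2
      apply h
      rw [← h1, h2]; ring
    · rw [omg, if_neg hg, zero_mul]

end GLR

namespace GLR
open MvPolynomial

/-- the `k × n` board -/
def board (k n : ℕ) : Finset (Cell k) :=
  (Finset.univ : Finset (Fin k × Fin n)).image fun x => cell x.1 ((x.2 : ℕ) : ℤ)

theorem mem_board {k n : ℕ} {x : Cell k} : x ∈ board k n ↔ 0 ≤ col x ∧ col x < n := by
  simp only [board, Finset.mem_image, Finset.mem_univ, true_and, Prod.exists]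
  constructor
  · rintro ⟨i, j, rfl⟩; simp
  · rintro ⟨h1, h2⟩
    refine ⟨row x, ⟨(col x).toNat, by omega⟩, ?_⟩
    conv_rhs => rw [← cell_row_col x]
    rw [cell_inj]
    exact ⟨rfl, by simp [h1]⟩

theorem card_board (k n : ℕ) : (board k n).card = k * n := by
  rw [board, Finset.card_image_of_injective, Finset.card_univ, Fintype.card_prod, Fintype.card_fin,
    Fintype.card_fin]
  rintro ⟨i, j⟩ ⟨i', j'⟩ h
  obtain ⟨h1, h2⟩ := cell_inj.1 h
  simp only at h1 h2
  rw [h1, Fin.ext (Int.ofNat_inj.1 h2)]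

/-- positions as integers -/
def zz {k m : ℕ} (t : Fin k → Fin m) : Fin k → ℤ := fun i => ((t i : ℕ) : ℤ)

theorem zz_inj {k m : ℕ} {t t' : Fin k → Fin m} (h : zz t = zz t') : t = t' := by
  funext i
  exact Fin.ext (Int.ofNat_inj.1 (congrFun h i))

open scoped Classical in
theorem sum_omg {k m : ℕ} (S : Fin k → Fin k → Finset ℤ) (Cs : Finset (Cell k))
    (hC : Cs ⊆ board k m) (f : Finset (Cell k) → ℚ) :
    ∑ B ∈ Cs.powerset, omg S B * f B = ∑ t : Fin k → Fin m,
      if Good S (zz t) ∧ graph (zz t) ⊆ Cs then f (graph (zz t)) else 0 := by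
  rw [← Finset.sum_filter]
  symm
  refine Finset.sum_of_injOn (fun t => graph (zz t)) ?_ ?_ ?_ ?_
  · intro t _ t' _ h
    exact zz_inj (graph_inj h)
  · intro t ht
    simp only [Finset.coe_filter, Set.mem_setOf_eq] at ht
    exact Finset.mem_coe.2 (Finset.mem_powerset.2 ht.2.2)
  · intro B hB h
    rw [omg, if_neg, zero_mul]
    rintro ⟨j, hj, rfl⟩
    apply h
    rw [Finset.mem_powerset] at hB
    have hj' : ∀ i, 0 ≤ j i ∧ j i < m := fun i => by
      have := mem_board.1 (hC (hB (mem_graph.2 (show col (cell i (j i)) = j (row (cell i (j i))) from rfl))))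
      simpa using this
    have e : zz (fun i => (⟨(j i).toNat, by have := hj' i; omega⟩ : Fin m)) = j := by
      funext i
      simp [zz, (hj' i).1]
    refine ⟨fun i => (⟨(j i).toNat, by have := hj' i; omega⟩ : Fin m), ?_, by simp only [e]⟩
    simp only [Finset.coe_filter, Set.mem_setOf_eq, Finset.mem_univ, true_and, e]
    exact ⟨hj, hB⟩
  · intro t ht
    simp only [Finset.mem_filter] at ht
    rw [omg, if_pos ⟨_, ht.2.1, rfl⟩, one_mul]

/-- `J` tiles the set `Cs` of cells. -/
def Tile {k m n : ℕ} (S : Fin k → Fin k → Finset ℤ) (J : Fin n → Fin k → Fin m)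
    (Cs : Finset (Cell k)) : Prop :=
  (∀ v, Good S (zz (J v))) ∧ (∀ x, x ∈ Cs ↔ ∃ v, x ∈ graph (zz (J v))) ∧
    ∀ v v' i, J v i = J v' i → v = v'

theorem tile_cons {k m n : ℕ} (S : Fin k → Fin k → Finset ℤ) (t : Fin k → Fin m)
    (J : Fin n → Fin k → Fin m) (Cs : Finset (Cell k)) :
    Tile S (Fin.cons t J : Fin (n + 1) → Fin k → Fin m) Cs ↔
      (Good S (zz t) ∧ graph (zz t) ⊆ Cs) ∧ Tile S J (Cs \ graph (zz t)) := by
  simp only [Tile, Fin.forall_fin_succ, Fin.exists_fin_succ, Fin.cons_zero, Fin.cons_succ,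
    Finset.mem_sdiff]
  constructor
  · rintro ⟨⟨h1, h2⟩, h3, ⟨-, h4⟩, h5⟩
    refine ⟨⟨h1, fun x hx => (h3 x).2 (Or.inl hx)⟩, h2, fun x => ?_, fun v v' i h => ?_⟩
    · rw [h3]
      constructor
      · rintro ⟨h | h, h'⟩
        · exact absurd h h'
        · exact h
      · rintro ⟨v, hv⟩
        refine ⟨Or.inr ⟨v, hv⟩, fun h' => ?_⟩
        rw [mem_graph] at hv h'
        have := h4 v (row x) (Fin.ext (Int.ofNat_inj.1 (h'.symm.trans hv)))
        exact absurd this.symm (Fin.succ_ne_zero v)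
    · exact Fin.succ_inj.1 ((h5 v).2 v' i h)
  · rintro ⟨⟨h1, h2⟩, h3, h4, h5⟩
    have key : ∀ v i, J v i ≠ t i := by
      intro v i h
      have := (h4 (cell i (zz t i))).2 ⟨v, mem_graph.2 (by simp [zz, h])⟩
      exact this.2 (mem_graph.2 (by simp))
    refine ⟨⟨h1, h3⟩, fun x => ?_, ⟨fun _ _ => trivial, fun v i h => absurd h.symm (key v i)⟩, fun v =>
      ⟨fun i h => absurd h (key v i), fun v' i h => by rw [h5 v v' i h]⟩⟩
    rw [← h4]
    by_cases hx : x ∈ graph (zz t)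
    · simp [hx, h2 hx]
    · simp [hx]

open scoped Classical in
theorem Wn_eq_sum {k m : ℕ} (S : Fin k → Fin k → Finset ℤ) (n : ℕ) :
    ∀ Cs : Finset (Cell k), Cs ⊆ board k m →
      Wn S n Cs = ∑ J : Fin n → Fin k → Fin m, if Tile S J Cs then (1 : ℚ) else 0 := by
  induction n with
  | zero =>
    intro Cs _
    rw [Wn, Fintype.sum_unique]
    congr 1
    simp [Tile, Finset.eq_empty_iff_forall_notMem]
  | succ n ih =>
    intro Cs hC
    rw [Wn, sum_omg S Cs hC fun B => Wn S n (Cs \ B)]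
    rw [← (Fin.consEquiv fun _ : Fin (n + 1) => (Fin k → Fin m)).sum_comp, Fintype.sum_prod_type]
    refine Finset.sum_congr rfl fun t _ => ?_
    have e : ∀ J : Fin n → Fin k → Fin m,
        Tile S ((Fin.consEquiv fun _ : Fin (n + 1) => (Fin k → Fin m)) (t, J)) Cs ↔
          (Good S (zz t) ∧ graph (zz t) ⊆ Cs) ∧ Tile S J (Cs \ graph (zz t)) :=
      fun J => tile_cons S t J Cs
    simp only [e]
    by_cases h : Good S (zz t) ∧ graph (zz t) ⊆ Cs
    · rw [if_pos h, ih _ (Finset.sdiff_subset.trans hC)]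
      simp [h]
    · rw [if_neg h]
      simp [h]

theorem tile_board {k n : ℕ} (S : Fin k → Fin k → Finset ℤ) (J : Fin n → Fin k → Fin n) :
    Tile S J (board k n) ↔ (∀ v, Good S (zz (J v))) ∧ ∀ i, Function.Bijective fun v => J v i := by
  constructor
  · rintro ⟨h1, -, h3⟩
    exact ⟨h1, fun i => Finite.injective_iff_bijective.1 fun v v' h => h3 v v' i h⟩
  · rintro ⟨h1, h2⟩
    refine ⟨h1, fun x => ?_, fun v v' i h => (h2 i).1 h⟩
    rw [mem_board]
    simp only [mem_graph]
    constructor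
    · rintro ⟨h3, h4⟩
      obtain ⟨v, hv⟩ := (h2 (row x)).2 ⟨(col x).toNat, by omega⟩
      refine ⟨v, ?_⟩
      simp only at hv
      simp [zz, hv, h3]
    · rintro ⟨v, hv⟩
      rw [hv]
      simp [zz]

theorem card_full {k n : ℕ} (hk : 1 ≤ k) (S : Fin k → Fin k → Finset ℤ) :
    Nat.card {J : Fin n → Fin k → Fin n // Tile S J (board k n)} =
      n.factorial * Nat.card {M : Fin k → Fin n → Fin n //
        IsGenLatinRect k n S M ∧ IsReducedGenLatinRect k n M} := by
  have e : n.factorial = Nat.card (Equiv.Perm (Fin n)) := by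
    rw [Nat.card_perm, Nat.card_fin]
  rw [e, ← Nat.card_prod]
  symm
  let z : Fin k := ⟨0, hk⟩
  let inv : ∀ (M : {M : Fin k → Fin n → Fin n //
        IsGenLatinRect k n S M ∧ IsReducedGenLatinRect k n M}) (i : Fin k), Equiv.Perm (Fin n) :=
    fun M i => Equiv.ofBijective (M.1 i) (M.2.1.1 i)
  have hinv : ∀ M i j, inv M i j = M.1 i j := fun M i j => rfl
  have hz : ∀ M j, (inv M z).symm j = j := by
    intro M j
    rw [Equiv.symm_apply_eq, hinv, M.2.2 z rfl]
  refine Nat.card_congr (Equiv.ofBijective (fun x => ⟨fun v i => (inv x.2 i).symm (x.1 v), ?_⟩) ⟨?_, ?_⟩)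
  · rw [tile_board]
    constructor
    · intro v i i' hi hs
      refine x.2.2.1.2 i i' hi _ _ hs ?_
      rw [← hinv, ← hinv, Equiv.apply_symm_apply, Equiv.apply_symm_apply]
    · intro i
      exact (inv x.2 i).symm.bijective.comp x.1.bijective
  · rintro ⟨σ, M⟩ ⟨σ', M'⟩ h
    have h' : ∀ v i, (inv M i).symm (σ v) = (inv M' i).symm (σ' v) := fun v i =>
      congrFun (congrFun (congrArg Subtype.val h) v) i
    have h1 : σ = σ' := by
      ext v
      have := h' v z
      rw [hz, hz] at this
      rw [this]
    subst h1
    refine Prod.ext rfl (Subtype.ext ?_)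
    funext i j
    have := h' (σ.symm (M.1 i j)) i
    rw [Equiv.apply_symm_apply, ← hinv, Equiv.symm_apply_apply, Equiv.eq_symm_apply] at this
    exact this.symm
  · rintro ⟨J, hJ⟩
    rw [tile_board] at hJ
    obtain ⟨h1, h2⟩ := hJ
    let τ : Fin k → Equiv.Perm (Fin n) := fun i => Equiv.ofBijective (fun v => J v i) (h2 i)
    have hτ : ∀ i v, τ i v = J v i := fun i v => rfl
    let M : Fin k → Fin n → Fin n := fun i j => τ z ((τ i).symm j)
    have hM : IsGenLatinRect k n S M ∧ IsReducedGenLatinRect k n M := by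
      refine ⟨⟨fun i => (τ z).bijective.comp (τ i).symm.bijective, ?_⟩, ?_⟩
      · intro i i' hi j j' hs he
        have h3 : (τ i).symm j = (τ i').symm j' := (τ z).injective he
        apply h1 ((τ i).symm j) i i' hi
        have h4 : J ((τ i).symm j) i = j := by rw [← hτ, Equiv.apply_symm_apply]
        have h5 : J ((τ i).symm j) i' = j' := by rw [← hτ, h3, Equiv.apply_symm_apply]
        simp only [zz, h4, h5]
        exact hs
      · intro i hi j
        have : i = z := Fin.ext hi
        subst this
        simp only [M, Equiv.apply_symm_apply]
    refine ⟨(τ z, ⟨M, hM⟩), Subtype.ext ?_⟩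
    funext v i
    simp only
    rw [Equiv.symm_apply_eq, hinv]
    simp only [M]
    rw [← hτ i, Equiv.symm_apply_apply]

theorem Wn_board {k n : ℕ} (hk : 1 ≤ k) (S : Fin k → Fin k → Finset ℤ) :
    Wn S n (board k n) = n.factorial * (Set.ncard {M : Fin k → Fin n → Fin n |
      IsGenLatinRect k n S M ∧ IsReducedGenLatinRect k n M} : ℚ) := by
  classical
  rw [Wn_eq_sum (m := n) S n _ (Finset.Subset.refl _), Finset.sum_boole, ← Fintype.card_subtype,
    ← Nat.card_eq_fintype_card]
  rw [card_full hk S]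
  push_cast
  rfl

theorem lam_board {k n : ℕ} (hk : 1 ≤ k) (S : Fin k → Fin k → Finset ℤ) (c : Ty k →₀ ℚ)
    (hc : ∀ j : Fin k → ℤ, (∑ T ∈ c.support, c T * (open scoped Classical in if chi T j then 1 else 0))
      = (open scoped Classical in if Good S j then 1 else 0)) :
    lam (qpoly c) (qpoly_const hk c) (rp (PBk c.support) (board k n)) =
      (Set.ncard {M : Fin k → Fin n → Fin n |
        IsGenLatinRect k n S M ∧ IsReducedGenLatinRect k n M} : ℚ) := by
  change (∑ᶠ N : ℕ, (N.factorial : ℚ)⁻¹ *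
    constantCoeff (pd (qpoly c ^ N) (rp (PBk c.support) (board k n)))) = _
  rw [finsum_eq_single _ n]
  · rw [constantCoeff_pd_pow S c hc, Wn_board hk S, inv_mul_cancel_left₀]
    exact_mod_cast n.factorial_ne_zero
  · intro N hN
    rw [constantCoeff_pd_pow S c hc, Wn_eq_zero, mul_zero]
    rw [card_board]
    intro h
    exact hN (Nat.eq_of_mul_eq_mul_left hk h).symm

end GLR

namespace GLR
open MvPolynomial

theorem rp_map {α β : Type*} [LinearOrder α] [Fintype β] (PB : β → Finset α → Prop) (e : α ≃o α)
    (he : ∀ b B, PB b (B.map e.toEquiv.toEmbedding) ↔ PB b B) (C : Finset α) :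
    rp PB (C.map e.toEquiv.toEmbedding) = rp PB C := by
  classical
  induction C using Finset.strongInduction with
  | H C ih =>
  by_cases h : C.Nonempty
  swap
  · rw [Finset.not_nonempty_iff_eq_empty] at h
    subst h
    simp
  have h' : (C.map e.toEquiv.toEmbedding).Nonempty := h.map
  have hmin : (C.map e.toEquiv.toEmbedding).min' h' = e (C.min' h) := by
    apply le_antisymm
    · exact Finset.min'_le _ _ (Finset.mem_map.2 ⟨_, Finset.min'_mem _ _, rfl⟩)
    · apply Finset.le_min'
      intro y hy
      obtain ⟨x, hx, rfl⟩ := Finset.mem_map.1 hy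
      exact e.monotone (Finset.min'_le _ _ hx)
  rw [rp_eq PB _ h', rp_eq PB _ h, hmin]
  refine Finset.sum_congr rfl fun b _ => ?_
  symm
  refine Finset.sum_equiv e.toEquiv.finsetCongr ?_ ?_
  · intro B
    simp only [Finset.mem_filter, Finset.mem_powerset, Equiv.finsetCongr_apply, he,
      Finset.map_subset_map]
    rw [show e (C.min' h) = e.toEquiv.toEmbedding (C.min' h) from rfl, Finset.mem_map']
  · intro B hB
    simp only [Finset.mem_filter, Finset.mem_powerset] at hB
    rw [Equiv.finsetCongr_apply, ← ih _ (Finset.sdiff_ssubset hB.1 ⟨_, hB.2.1⟩), Finset.map_sdiff]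

theorem cell_lt {k : ℕ} {x y : Cell k} (h : col x < col y) : x < y := by
  rw [Prod.Lex.lt_iff]; exact Or.inl h

/-- translation of cells -/
def shE {k : ℕ} (d : ℤ) : Cell k ≃o Cell k where
  toFun x := cell (row x) (col x + d)
  invFun x := cell (row x) (col x - d)
  left_inv x := by simp
  right_inv x := by simp
  map_rel_iff' := by
    intro x y
    simp only [Equiv.coe_fn_mk, Prod.Lex.le_iff]
    show (col x + d < col y + d ∨ col x + d = col y + d ∧ row x ≤ row y) ↔
      (col x < col y ∨ col x = col y ∧ row x ≤ row y)
    simp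

def sh {k : ℕ} (d : ℤ) (s : Finset (Cell k)) : Finset (Cell k) :=
  s.map (shE d).toEquiv.toEmbedding

theorem mem_sh {k : ℕ} {d : ℤ} {s : Finset (Cell k)} {x : Cell k} :
    x ∈ sh d s ↔ cell (row x) (col x - d) ∈ s := by
  rw [sh, Finset.mem_map_equiv]; rfl

theorem PBk_sh {k : ℕ} (𝒯 : Finset (Ty k)) (d : ℤ) (b : 𝒯 × Fin k) (B : Finset (Cell k)) :
    PBk 𝒯 b (sh d B) ↔ PBk 𝒯 b B := by
  unfold PBk
  refine and_congr_right fun _ => ?_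
  constructor
  · rintro ⟨p, hp⟩
    refine ⟨p - d, ?_⟩
    ext x
    have : x ∈ B ↔ cell (row x) (col x + d) ∈ sh d B := by rw [mem_sh]; simp
    rw [this, hp, mem_blk, mem_blk]
    simp only [row_cell, col_cell]
    refine and_congr_right fun _ => ?_
    constructor <;> intro h <;> linarith
  · rintro ⟨p, rfl⟩
    refine ⟨p + d, ?_⟩
    ext x
    rw [mem_sh, mem_blk, mem_blk]
    simp only [row_cell, col_cell]
    refine and_congr_right fun _ => ?_
    constructor <;> intro h <;> linarith

theorem rp_sh {k : ℕ} (𝒯 : Finset (Ty k)) (d : ℤ) (C : Finset (Cell k)) :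
    rp (PBk 𝒯) (sh d C) = rp (PBk 𝒯) C :=
  rp_map (PBk 𝒯) (shE d) (PBk_sh 𝒯 d) C

theorem exists_bound {k : ℕ} (𝒯 : Finset (Ty k)) : ∃ ρ : ℕ, ∀ b B, PBk 𝒯 b B →
    ∀ x ∈ B, ∀ y ∈ B, col x ≤ col y + ρ := by
  refine ⟨(Finset.univ : Finset (𝒯 × Fin k × Fin k)).sup
    fun x => (x.1.1.2 x.2.1 - x.1.1.2 x.2.2).natAbs, ?_⟩
  rintro b B ⟨-, p, rfl⟩ x hx y hy
  rw [mem_blk] at hx hy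
  have := Finset.le_sup (f := fun x : 𝒯 × Fin k × Fin k => (x.1.1.2 x.2.1 - x.1.1.2 x.2.2).natAbs)
    (Finset.mem_univ (b.1, row x, row y))
  simp only at this
  rw [hx.2, hy.2]
  omega

/-- generating function with some initial cells removed -/
noncomputable def Gs {k : ℕ} (𝒯 : Finset (Ty k)) (u : Finset (Cell k)) : PS (𝒯 × Fin k) :=
  PowerSeries.mk fun n => if u ⊆ board k n then rp (PBk 𝒯) (board k n \ u) else 0

theorem board_zero (k : ℕ) : board k 0 = ∅ := by
  apply Finset.eq_empty_of_forall_notMem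
  intro x hx
  have := mem_board.1 hx
  simp at this
  omega

theorem board_mono {k n m : ℕ} (h : n ≤ m) : board k n ⊆ board k m := by
  intro x hx
  rw [mem_board] at hx ⊢
  omega

theorem Gs_shift {k : ℕ} (hk : 1 ≤ k) (𝒯 : Finset (Ty k)) (u : Finset (Cell k)) (hu : board k 1 ⊆ u)
    (hu0 : ∀ x ∈ u, 0 ≤ col x) :
    Gs 𝒯 u = PowerSeries.X * Gs 𝒯 (sh (-1) (u \ board k 1)) := by
  ext1 n
  cases n with
  | zero =>
    rw [PowerSeries.coeff_zero_X_mul, Gs, PowerSeries.coeff_mk, if_neg]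
    intro h
    have h0 : cell (⟨0, hk⟩ : Fin k) 0 ∈ board k 1 := mem_board.2 (by simp)
    have := h (hu h0)
    rw [board_zero] at this
    simp at this
  | succ n =>
    rw [PowerSeries.coeff_succ_X_mul, Gs, Gs, PowerSeries.coeff_mk, PowerSeries.coeff_mk]
    have e1 : u ⊆ board k (n + 1) ↔ sh (-1) (u \ board k 1) ⊆ board k n := by
      constructor
      · intro h x hx
        rw [mem_sh, Finset.mem_sdiff] at hx
        have h1 := mem_board.1 (h hx.1)
        have h2 := mt mem_board.2 hx.2
        simp only [col_cell] at h1 h2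
        rw [mem_board]
        push_cast at h1 h2
        omega
      · intro h x hx
        by_cases hx1 : x ∈ board k 1
        · exact board_mono (by omega) hx1
        · have : cell (row x) (col x - 1) ∈ sh (-1) (u \ board k 1) := by
            rw [mem_sh]; simp [hx, hx1]
          have h1 := mem_board.1 (h this)
          rw [mem_board]
          simp only [col_cell] at h1
          push_cast
          omega
    have e2 : board k n \ sh (-1) (u \ board k 1) = sh (-1) (board k (n + 1) \ u) := by
      ext x
      rw [Finset.mem_sdiff, mem_sh, mem_sh, Finset.mem_sdiff, Finset.mem_sdiff, mem_board, mem_board,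
        mem_board]
      simp only [col_cell]
      by_cases hx : cell (row x) (col x - -1) ∈ u
      · have := hu0 _ hx
        simp only [col_cell] at this
        simp only [hx, true_and, not_true, and_false, iff_false, not_and, not_not]
        intro h1
        push_cast
        omega
      · have h3 : ¬ (0 ≤ col x - -1 ∧ col x - -1 < ((1 : ℕ) : ℤ)) :=
          fun h => hx (hu (mem_board.2 h))
        simp only [hx, false_and, not_false_eq_true, and_true]
        push_cast at h3 ⊢
        omega
    simp only [e1, e2, rp_sh]

open scoped Classical in
theorem Gs_step {k : ℕ} (𝒯 : Finset (Ty k)) (ρ : ℕ)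
    (hρ : ∀ b B, PBk 𝒯 b B → ∀ x ∈ B, ∀ y ∈ B, col x ≤ col y + ρ)
    (u : Finset (Cell k)) (h : (board k 1 \ u).Nonempty) :
    Gs 𝒯 u = PowerSeries.C (if u = ∅ then 1 else 0) +
      ∑ b : 𝒯 × Fin k, ∑ B ∈ (board k (ρ + 1) \ u).powerset.filter
        (fun B => (board k 1 \ u).min' h ∈ B ∧ PBk 𝒯 b B), (X b : MvPolynomial (𝒯 × Fin k) ℚ) • Gs 𝒯 (u ∪ B) := by
  set z := (board k 1 \ u).min' h with hz
  have hz1 : z ∈ board k 1 \ u := Finset.min'_mem _ _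
  rw [Finset.mem_sdiff] at hz1
  have hz2 := mem_board.1 hz1.1
  ext1 n
  rw [map_add, map_sum]
  simp only [map_sum, PowerSeries.coeff_smul]
  cases n with
  | zero =>
    rw [Finset.sum_eq_zero]
    · rw [Gs, PowerSeries.coeff_mk, board_zero, PowerSeries.coeff_zero_C, add_zero]
      by_cases hu : u = ∅ <;> simp [rp_empty, hu]
    · intro b _
      refine Finset.sum_eq_zero fun B hB => ?_
      simp only [Finset.mem_filter, Finset.mem_powerset] at hB
      rw [Gs, PowerSeries.coeff_mk, board_zero, if_neg, smul_zero]
      intro h2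
      have := h2 (Finset.mem_union_right _ hB.2.1)
      simp at this
  | succ n =>
    rw [PowerSeries.coeff_C, if_neg (Nat.succ_ne_zero n), zero_add]
    simp only [Gs, PowerSeries.coeff_mk]
    by_cases hu : u ⊆ board k (n + 1)
    · rw [if_pos hu]
      have hzC : z ∈ board k (n + 1) \ u := Finset.mem_sdiff.2 ⟨board_mono (by omega) hz1.1, hz1.2⟩
      have hmin : (board k (n + 1) \ u).min' ⟨z, hzC⟩ = z := by
        apply le_antisymm
        · exact Finset.min'_le _ _ hzC
        · apply Finset.le_min'
          intro y hy
          rw [Finset.mem_sdiff] at hy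
          by_cases hy1 : y ∈ board k 1
          · exact Finset.min'_le _ _ (Finset.mem_sdiff.2 ⟨hy1, hy.2⟩)
          · apply le_of_lt
            apply cell_lt
            have h1 := mem_board.1 hy.1
            have h2 := mt mem_board.2 hy1
            push_cast at h1 h2 hz2
            omega
      rw [rp_eq _ _ ⟨z, hzC⟩, hmin]
      refine Finset.sum_congr rfl fun b _ => ?_
      simp only [smul_ite, smul_zero]
      rw [← Finset.sum_filter, Finset.filter_filter]
      refine Finset.sum_congr ?_ ?_
      · ext B
        simp only [Finset.mem_filter, Finset.mem_powerset, Finset.subset_sdiff]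
        constructor
        · rintro ⟨⟨h1, h2⟩, h3, h4⟩
          refine ⟨⟨fun x hx => ?_, h2⟩, ⟨h3, h4⟩, Finset.union_subset hu h1⟩
          have h5 := hρ b B h4 x hx z h3
          have h6 := mem_board.1 (h1 hx)
          rw [mem_board]
          push_cast at *
          omega
        · rintro ⟨⟨h1, h2⟩, ⟨h3, h4⟩, h5⟩
          exact ⟨⟨Finset.subset_union_right.trans h5, h2⟩, h3, h4⟩
      · intro B _
        rw [smul_eq_mul, sdiff_sdiff_left]; rfl
    · rw [if_neg hu]
      symm
      refine Finset.sum_eq_zero fun b _ => Finset.sum_eq_zero fun B _ => ?_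
      rw [if_neg, smul_zero]
      intro h2
      exact hu (Finset.subset_union_left.trans h2)

theorem Gs_mem {k : ℕ} (hk : 1 ≤ k) (𝒯 : Finset (Ty k)) (ρ : ℕ)
    (hρ : ∀ b B, PBk 𝒯 b B → ∀ x ∈ B, ∀ y ∈ B, col x ≤ col y + ρ) (m : ℕ) :
    ∀ (u : Finset (Cell k)), u ⊆ board k (ρ + 1) → (board k 1 \ u).card = m →
    Gs 𝒯 u ∈ Submodule.span (MvPolynomial (𝒯 × Fin k) ℚ) (insert 1
      (Set.range fun v : (board k (ρ + 1)).powerset => PowerSeries.X * Gs 𝒯 v.1)) := by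
  classical
  induction m using Nat.strong_induction_on with
  | _ m ih =>
  intro u hu hm
  by_cases h : (board k 1 \ u).Nonempty
  · rw [Gs_step 𝒯 ρ hρ u h]
    refine Submodule.add_mem _ ?_ (Submodule.sum_mem _ fun b _ => Submodule.sum_mem _ fun B hB =>
      Submodule.smul_mem _ _ ?_)
    · rw [← mul_one (PowerSeries.C _), ← PowerSeries.smul_eq_C_mul]
      exact Submodule.smul_mem _ _ (Submodule.subset_span (Set.mem_insert _ _))
    · simp only [Finset.mem_filter, Finset.mem_powerset] at hB
      refine ih _ ?_ (u ∪ B) (Finset.union_subset hu (hB.1.trans Finset.sdiff_subset)) rfl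
      rw [← hm]
      apply Finset.card_lt_card
      rw [Finset.ssubset_iff_of_subset (Finset.sdiff_subset_sdiff (Finset.Subset.refl _)
        Finset.subset_union_left)]
      exact ⟨_, Finset.min'_mem _ h, by simp [hB.2.1]⟩
  · rw [Finset.not_nonempty_iff_eq_empty, Finset.sdiff_eq_empty_iff_subset] at h
    rw [Gs_shift hk 𝒯 u h fun x hx => (mem_board.1 (hu hx)).1]
    refine Submodule.subset_span (Set.mem_insert_of_mem _ ⟨⟨sh (-1) (u \ board k 1), ?_⟩, rfl⟩)
    rw [Finset.mem_powerset]
    intro x hx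
    rw [mem_sh, Finset.mem_sdiff] at hx
    have h1 := mem_board.1 (hu hx.1)
    have h2 := mt mem_board.2 hx.2
    simp only [col_cell] at h1 h2
    rw [mem_board]
    push_cast at *
    omega

theorem rational_of_system {R ι : Type*} [CommRing R] [Nontrivial R] [Fintype ι] [DecidableEq ι]
    (G : ι → PowerSeries R) (e : ι → R) (m : ι → ι → R)
    (h : ∀ u, G u = e u • (1 : PowerSeries R) + ∑ v, m u v • (PowerSeries.X * G v)) (u : ι) :
    ∃ Dp Np : Polynomial R, Dp ≠ 0 ∧ (Dp : PowerSeries R) * G u = Np := by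
  let A : Matrix ι ι (Polynomial R) := 1 - Matrix.of fun u v => Polynomial.C (m u v) * Polynomial.X
  let φ : Polynomial R →+* PowerSeries R := Polynomial.coeToPowerSeries.ringHom
  have hφ : ∀ p, φ p = (p : PowerSeries R) := fun p => rfl
  refine ⟨A.det, (A.adjugate.mulVec fun u => Polynomial.C (e u)) u, ?_, ?_⟩
  · intro h0
    have h1 := congrArg (Polynomial.evalRingHom (0 : R)) h0
    rw [RingHom.map_det, map_zero] at h1
    have : (Polynomial.evalRingHom (0 : R)).mapMatrix A = 1 := by
      ext u v
      simp [A, Matrix.one_apply, apply_ite]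
    rw [this, Matrix.det_one] at h1
    exact one_ne_zero h1
  · have hA : (φ.mapMatrix A).mulVec G = fun u => φ (Polynomial.C (e u)) := by
      have : φ.mapMatrix A = 1 - Matrix.of fun u v => PowerSeries.C (m u v) * PowerSeries.X := by
        simp only [A, map_sub, map_one]
        congr 1
        ext1 u v
        simp [hφ]
      rw [this, Matrix.sub_mulVec, Matrix.one_mulVec]
      funext u
      rw [Pi.sub_apply]
      conv_lhs => rw [h u]
      rw [sub_eq_iff_eq_add]
      congr 1
      · rw [PowerSeries.smul_eq_C_mul, mul_one, hφ, Polynomial.coe_C]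
      · simp only [Matrix.mulVec, dotProduct, Matrix.of_apply]
        refine Finset.sum_congr rfl fun v _ => ?_
        rw [PowerSeries.smul_eq_C_mul, mul_assoc]
    have h2 := congrArg (fun w => ((φ.mapMatrix A).adjugate.mulVec w) u) hA
    simp only [Matrix.mulVec_mulVec, Matrix.adjugate_mul, Matrix.smul_mulVec, Matrix.one_mulVec,
      Pi.smul_apply, smul_eq_mul] at h2
    rw [← hφ, ← hφ, RingHom.map_det, h2, ← RingHom.map_adjugate, RingHom.map_mulVec]
    rfl

theorem board_rational {k : ℕ} (hk : 1 ≤ k) (𝒯 : Finset (Ty k)) :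
    ∃ Dp Np : Polynomial (MvPolynomial (𝒯 × Fin k) ℚ), Dp ≠ 0 ∧
      (Dp : PS (𝒯 × Fin k)) * PowerSeries.mk (fun n => rp (PBk 𝒯) (board k n)) = Np := by
  classical
  obtain ⟨ρ, hρ⟩ := exists_bound 𝒯
  have key : ∀ u : (board k (ρ + 1)).powerset, ∃ (e : MvPolynomial (𝒯 × Fin k) ℚ)
      (m : (board k (ρ + 1)).powerset → MvPolynomial (𝒯 × Fin k) ℚ),
      Gs 𝒯 u.1 = e • (1 : PS (𝒯 × Fin k)) + ∑ v, m v • (PowerSeries.X * Gs 𝒯 v.1) := by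
    intro u
    have := Gs_mem hk 𝒯 ρ hρ _ u.1 (Finset.mem_powerset.1 u.2) rfl
    rw [Submodule.mem_span_insert] at this
    obtain ⟨e, w, hw, h⟩ := this
    rw [Submodule.mem_span_range_iff_exists_fun] at hw
    obtain ⟨m, rfl⟩ := hw
    exact ⟨e, m, h⟩
  choose e m h using key
  have := rational_of_system (fun u : (board k (ρ + 1)).powerset => Gs 𝒯 u.1) e m h
    ⟨∅, Finset.empty_mem_powerset _⟩
  simpa [Gs] using this

end GLR

theorem genLatinRect_P_recursive
    (k : ℕ) (hk : 1 ≤ k) (S : Fin k → Fin k → Finset ℤ)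
    (a : ℕ → ℕ)
    (ha : ∀ n : ℕ, a n = Set.ncard {M : Fin k → Fin n → Fin n |
      IsGenLatinRect k n S M ∧ IsReducedGenLatinRect k n M}) :
    ∃ (d : ℕ) (p : ℕ → Polynomial ℚ),
      (∃ i ≤ d, p i ≠ 0) ∧
      ∃ N : ℕ, ∀ n ≥ N,
        ∑ i ∈ Finset.range (d + 1), (p i).eval (n : ℚ) * (a (n + i) : ℚ) = 0 := by
  classical
  obtain ⟨c, hc⟩ := GLR.exists_types S
  obtain ⟨Dp, Np, hD, hR⟩ := GLR.board_rational hk c.support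
  obtain ⟨e, A, hA, h⟩ := GLR.holonomic_core (GLR.qpoly c) (GLR.qpoly_const hk c) _ Dp Np hD hR
  refine GLR.recurrence_of_core (fun n => (a n : ℚ)) e A hA fun n => ?_
  have h' := h n
  have hs : ∀ n, GLR.lam (GLR.qpoly c) (GLR.qpoly_const hk c)
      (GLR.rp (GLR.PBk c.support) (GLR.board k n)) = (a n : ℚ) := fun n => by
    rw [ha n]
    exact GLR.lam_board hk S c (fun j => by convert hc j)
  simp only [PowerSeries.coeff_mk] at h'
  rw [← h']
  refine Finset.sum_congr rfl fun i _ => Finset.sum_congr rfl fun j _ => ?_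
  rw [← hs]
  try congr
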